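/- arXiv:1806.10085 — 3 statements merged into one kernel-verified Lean document; each statement's English description precedes it below -/
import Mathlib

section
/- The little BMO norm is comparable to the maximum of the essential suprema of the one-parameter BMO norms of the slices: for locally integrable b : ℝ^{n+m} → ℂ, ‖b‖_{bmo(𝒟)} is comparable (up to dimensional constants) to max(ess sup_{x₁} ‖b(x₁,·)‖_{BMO(𝒟ᵐ)}, ess sup_{x₂} ‖b(·,x₂)‖_{BMO(𝒟ⁿ)}). -/
open MeasureTheory Set Filter Topology ENNReal NNReal

noncomputable section

/-- The dyadic cube `∏ᵢ [2^{-k} nᵢ, 2^{-k}(nᵢ+1))` in `ℝᵈ`. -/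
def dyadicCube (d : ℕ) (k : ℤ) (n : Fin d → ℤ) : Set (Fin d → ℝ) :=
  {x | ∀ i, (2:ℝ)^(-k) * (n i) ≤ x i ∧ x i < (2:ℝ)^(-k) * ((n i) + 1)}

/-- The dyadic child of `dyadicCube d k n` determined by the offsets `t`. -/
def dyadicChild (d : ℕ) (k : ℤ) (n : Fin d → ℤ) (t : Fin d → Fin 2) : Set (Fin d → ℝ) :=
  dyadicCube d (k+1) (fun i => 2 * n i + (t i : ℕ))

/-- The average `⟨f⟩_S = |S|⁻¹ ∫_S f`. -/
def setAvg {X : Type*} [MeasureSpace X] (f : X → ℂ) (S : Set X) : ℂ :=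
  (volume S).toReal⁻¹ • ∫ x in S, f x

/-- The martingale difference `Δ_I f = Σ_{I' ∈ ch(I)} (⟨f⟩_{I'} - ⟨f⟩_I) 1_{I'}` of the
dyadic cube `I = dyadicCube d k n`. -/
def mdiff (d : ℕ) (k : ℤ) (n : Fin d → ℤ) (f : (Fin d → ℝ) → ℂ) : (Fin d → ℝ) → ℂ :=
  fun x => ∑ t : Fin d → Fin 2,
    (dyadicChild d k n t).indicator
      (fun _ => setAvg f (dyadicChild d k n t) - setAvg f (dyadicCube d k n)) x

/-- The (extended-real valued) mean oscillation `|S|⁻¹ ∫_S |b − ⟨b⟩_S|`. -/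
def oscE {X : Type*} [MeasureSpace X] (b : X → ℂ) (S : Set X) : ℝ≥0∞ :=
  (volume S)⁻¹ * ∫⁻ x in S, (‖b x - setAvg b S‖₊ : ℝ≥0∞)

/-- The dyadic BMO norm in `ℝᵈ` (supremum of oscillations over dyadic cubes). -/
def bmoD (d : ℕ) (g : (Fin d → ℝ) → ℂ) : ℝ≥0∞ :=
  ⨆ (k : ℤ) (nn : Fin d → ℤ), oscE g (dyadicCube d k nn)

/-- The dyadic little BMO norm on `ℝⁿ × ℝᵐ` (supremum of oscillations over dyadic
rectangles `I × J`, `I ∈ 𝒟ⁿ`, `J ∈ 𝒟ᵐ`). -/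
def bmoRectD (n m : ℕ) (b : (Fin n → ℝ) × (Fin m → ℝ) → ℂ) : ℝ≥0∞ :=
  ⨆ (k : ℤ) (nn : Fin n → ℤ) (k' : ℤ) (mm : Fin m → ℤ),
    oscE b (dyadicCube n k nn ×ˢ dyadicCube m k' mm)

/-! ### Dyadic cubes -/

lemma dyadicCube_eq_pi (d : ℕ) (k : ℤ) (n : Fin d → ℤ) :
    dyadicCube d k n = Set.pi univ
      (fun i => Ico ((2:ℝ)^(-k) * (n i)) ((2:ℝ)^(-k) * ((n i) + 1))) := by
  ext x
  simp [dyadicCube, Set.mem_pi]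

lemma measurableSet_dyadicCube (d : ℕ) (k : ℤ) (n : Fin d → ℤ) :
    MeasurableSet (dyadicCube d k n) := by
  rw [dyadicCube_eq_pi]
  exact MeasurableSet.univ_pi fun i => measurableSet_Ico

/-- The center of the dyadic cube. -/
def dyadicCenter (d : ℕ) (k : ℤ) (n : Fin d → ℤ) : Fin d → ℝ :=
  fun i => (2:ℝ)^(-k) * (n i) + (2:ℝ)^(-k) / 2

lemma dyadicCube_ae_eq_closedBall (d : ℕ) (k : ℤ) (n : Fin d → ℤ) :
    dyadicCube d k n =ᵐ[volume] Metric.closedBall (dyadicCenter d k n) ((2:ℝ)^(-k) / 2) := by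
  have hp : (0:ℝ) < (2:ℝ)^(-k) := by positivity
  have h : Metric.closedBall (dyadicCenter d k n) ((2:ℝ)^(-k) / 2) =
      Icc (fun i => (2:ℝ)^(-k) * (n i)) (fun i => (2:ℝ)^(-k) * ((n i) + 1)) := by
    ext x
    rw [Metric.mem_closedBall, dist_pi_le_iff (by positivity)]
    simp only [mem_Icc, Pi.le_def, ← forall_and]
    refine forall_congr' fun i => ?_
    rw [Real.dist_eq, abs_le, dyadicCenter]
    constructor
    · rintro ⟨h1, h2⟩
      constructor <;> nlinarith
    · rintro ⟨h1, h2⟩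
      constructor <;> nlinarith
  rw [h, dyadicCube_eq_pi]
  exact Measure.univ_pi_Ico_ae_eq_Icc

lemma dyadicCube_subset_closedBall (d : ℕ) (k : ℤ) (n : Fin d → ℤ) :
    dyadicCube d k n ⊆ Metric.closedBall (dyadicCenter d k n) ((2:ℝ)^(-k) / 2) := by
  have hp : (0:ℝ) < (2:ℝ)^(-k) := by positivity
  intro x hx
  rw [Metric.mem_closedBall, dist_pi_le_iff (by positivity)]
  intro i
  have := hx i
  rw [Real.dist_eq, abs_le, dyadicCenter]
  constructor <;> nlinarith [this.1, this.2]

lemma volume_dyadicCube_ne_top (d : ℕ) (k : ℤ) (n : Fin d → ℤ) :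
    volume (dyadicCube d k n) ≠ ⊤ := by
  rw [measure_congr (dyadicCube_ae_eq_closedBall d k n)]
  exact measure_closedBall_lt_top.ne

lemma volume_dyadicCube_ne_zero (d : ℕ) (k : ℤ) (n : Fin d → ℤ) :
    volume (dyadicCube d k n) ≠ 0 := by
  rw [measure_congr (dyadicCube_ae_eq_closedBall d k n)]
  exact (Metric.measure_closedBall_pos volume _ (by positivity)).ne'

lemma exists_mem_dyadicCube (d : ℕ) (k : ℤ) (x : Fin d → ℝ) : ∃ n, x ∈ dyadicCube d k n := by
  have hp : (0:ℝ) < (2:ℝ)^(-k) := by positivity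
  refine ⟨fun i => ⌊x i / (2:ℝ)^(-k)⌋, fun i => ?_⟩
  have h1 := Int.floor_le (x i / (2:ℝ)^(-k))
  have h2 := Int.lt_floor_add_one (x i / (2:ℝ)^(-k))
  rw [le_div_iff₀ hp] at h1
  rw [div_lt_iff₀ hp] at h2
  constructor <;> linarith

/-- Dyadic Lebesgue differentiation, in the form of a pointwise bound. -/
lemma ae_le_of_dyadic_avg_le (d : ℕ) (F : (Fin d → ℝ) → ℝ≥0∞) (hF : AEMeasurable F volume)
    (c : ℝ≥0∞) (hc : c ≠ ⊤)
    (h : ∀ k n, ∫⁻ x in dyadicCube d k n, F x ≤ c * volume (dyadicCube d k n)) :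
    ∀ᵐ x, F x ≤ c := by
  have key : ∀ n₀ : Fin d → ℤ, ∀ᵐ x, (dyadicCube d 0 n₀).indicator F x ≤ c := by
    intro n₀
    have hm := measurableSet_dyadicCube d 0 n₀
    have hfin : ∫⁻ x, (dyadicCube d 0 n₀).indicator F x ≠ ⊤ := by
      rw [lintegral_indicator hm]
      exact ((h 0 n₀).trans_lt
        (ENNReal.mul_lt_top hc.lt_top (volume_dyadicCube_ne_top d 0 n₀).lt_top)).ne
    filter_upwards [(IsUnifLocDoublingMeasure.vitaliFamily
      (volume : Measure (Fin d → ℝ)) 1).ae_tendsto_lintegral_div (hF.indicator hm) hfin] with x hx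
    choose N hN using fun j : ℕ => exists_mem_dyadicCube d (j : ℤ) x
    have hlim : Tendsto (fun j : ℕ => (2:ℝ)^(-(j:ℤ)) / 2) atTop (𝓝[>] 0) := by
      rw [tendsto_nhdsWithin_iff]
      refine ⟨?_, Eventually.of_forall fun j => ?_⟩
      · have := (tendsto_pow_atTop_nhds_zero_of_lt_one (r := (1/2:ℝ)) (by norm_num)
          (by norm_num)).div_const 2
        simpa [zpow_neg] using this
      · rw [mem_Ioi]; positivity
    have ht := hx.comp (IsUnifLocDoublingMeasure.tendsto_closedBall_filterAt
      (μ := (volume : Measure (Fin d → ℝ))) (K := 1) (x := x)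
      (fun j : ℕ => dyadicCenter d j (N j)) _ hlim (Eventually.of_forall fun j => by
        rw [one_mul]; exact dyadicCube_subset_closedBall _ _ _ (hN j)))
    refine le_of_tendsto' ht fun j => ?_
    have hae := dyadicCube_ae_eq_closedBall d j (N j)
    simp only [Function.comp]
    rw [← measure_congr hae, ← Measure.restrict_congr_set hae]
    refine ENNReal.div_le_of_le_mul ?_
    refine (lintegral_mono fun y => ?_).trans (h j (N j))
    exact indicator_le_self _ _ _
  filter_upwards [ae_all_iff.2 key] with x hx
  obtain ⟨n₀, hn₀⟩ := exists_mem_dyadicCube d 0 x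
  simpa [indicator_of_mem hn₀] using hx n₀

/-! ### Averages -/

lemma setAvg_sub_enorm_le {X : Type*} [MeasureSpace X] (g : X → ℂ) (S : Set X)
    (h0 : volume S ≠ 0) (ht : volume S ≠ ⊤) (hg : IntegrableOn g S) (c : ℂ) :
    ‖setAvg g S - c‖ₑ ≤ (volume S)⁻¹ * ∫⁻ x in S, ‖g x - c‖ₑ := by
  have hr : (volume S).toReal ≠ 0 := (ENNReal.toReal_pos h0 ht).ne'
  have hcst : IntegrableOn (fun _ : X => c) S := integrableOn_const ht
  have e : setAvg g S - c = (volume S).toReal⁻¹ • ∫ x in S, (g x - c) := by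
    rw [integral_sub hg hcst, smul_sub, setAvg, setIntegral_const, measureReal_def, smul_smul,
      inv_mul_cancel₀ hr, one_smul]
  rw [e, enorm_smul]
  have : ‖(volume S).toReal⁻¹‖ₑ = (volume S)⁻¹ := by
    rw [← ENNReal.toReal_inv, Real.enorm_eq_ofReal ENNReal.toReal_nonneg,
      ENNReal.ofReal_toReal (ENNReal.inv_ne_top.2 h0)]
  rw [this]
  gcongr
  exact enorm_integral_le_lintegral_enorm _

lemma lintegral_sub_setAvg_le {X : Type*} [MeasureSpace X] (g : X → ℂ) (S : Set X)
    (h0 : volume S ≠ 0) (ht : volume S ≠ ⊤) (hg : IntegrableOn g S) (c : ℂ) :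
    ∫⁻ x in S, ‖g x - setAvg g S‖ₑ ≤ 2 * ∫⁻ x in S, ‖g x - c‖ₑ := by
  have h1 : ∀ x, ‖g x - setAvg g S‖ₑ ≤ ‖g x - c‖ₑ + ‖setAvg g S - c‖ₑ := fun x => by
    have : g x - setAvg g S = (g x - c) - (setAvg g S - c) := by ring
    rw [this]
    exact enorm_sub_le
  calc ∫⁻ x in S, ‖g x - setAvg g S‖ₑ
      ≤ ∫⁻ x in S, (‖g x - c‖ₑ + ‖setAvg g S - c‖ₑ) := lintegral_mono h1
    _ = (∫⁻ x in S, ‖g x - c‖ₑ) + ‖setAvg g S - c‖ₑ * volume S := by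
        rw [lintegral_add_right _ measurable_const, setLIntegral_const]
    _ ≤ (∫⁻ x in S, ‖g x - c‖ₑ) + ((volume S)⁻¹ * ∫⁻ x in S, ‖g x - c‖ₑ) * volume S := by
        gcongr
        exact setAvg_sub_enorm_le g S h0 ht hg c
    _ = 2 * ∫⁻ x in S, ‖g x - c‖ₑ := by
        rw [mul_right_comm, ENNReal.inv_mul_cancel h0 ht, one_mul, two_mul]

lemma oscE_eq {X : Type*} [MeasureSpace X] (b : X → ℂ) (S : Set X) :
    oscE b S = (volume S)⁻¹ * ∫⁻ x in S, ‖b x - setAvg b S‖ₑ := rfl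

lemma oscE_le_iff {X : Type*} [MeasureSpace X] (b : X → ℂ) (S : Set X)
    (h0 : volume S ≠ 0) (ht : volume S ≠ ⊤) (M : ℝ≥0∞) :
    oscE b S ≤ M ↔ ∫⁻ x in S, ‖b x - setAvg b S‖ₑ ≤ volume S * M := by
  rw [oscE_eq, ENNReal.inv_mul_le_iff h0 ht]

/-! ### Local integrability on rectangles -/

lemma integrable_rect {n m : ℕ} {b : (Fin n → ℝ) × (Fin m → ℝ) → ℂ} (hb : LocallyIntegrable b)
    (k : ℤ) (nn : Fin n → ℤ) (k' : ℤ) (mm : Fin m → ℤ) :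
    Integrable b ((volume.restrict (dyadicCube n k nn)).prod
      (volume.restrict (dyadicCube m k' mm))) := by
  rw [Measure.prod_restrict]
  have hK : IsCompact (Metric.closedBall (dyadicCenter n k nn) ((2:ℝ)^(-k) / 2) ×ˢ
      Metric.closedBall (dyadicCenter m k' mm) ((2:ℝ)^(-k') / 2)) :=
    (isCompact_closedBall _ _).prod (isCompact_closedBall _ _)
  exact (hb.integrableOn_isCompact hK).mono_set
    (prod_mono (dyadicCube_subset_closedBall _ _ _) (dyadicCube_subset_closedBall _ _ _))

lemma volume_rect {n m : ℕ} (I : Set (Fin n → ℝ)) (J : Set (Fin m → ℝ)) :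
    volume (I ×ˢ J) = volume I * volume J := Measure.prod_prod _ _

lemma restrict_rect {n m : ℕ} (I : Set (Fin n → ℝ)) (J : Set (Fin m → ℝ)) :
    (volume : Measure ((Fin n → ℝ) × (Fin m → ℝ))).restrict (I ×ˢ J) =
      (volume.restrict I).prod (volume.restrict J) := (Measure.prod_restrict _ _).symm

lemma aestronglyMeasurable_setAvg_slice {n m : ℕ} {b : (Fin n → ℝ) × (Fin m → ℝ) → ℂ}
    {μ : Measure (Fin n → ℝ)} {J : Set (Fin m → ℝ)}
    (hb : AEStronglyMeasurable b (μ.prod (volume.restrict J))) :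
    AEStronglyMeasurable (fun x => setAvg (fun y => b (x, y)) J) μ := by
  unfold setAvg
  exact hb.integral_prod_right'.const_smul ((volume J).toReal⁻¹)

lemma aemeasurable_osc {n m : ℕ} {b : (Fin n → ℝ) × (Fin m → ℝ) → ℂ}
    {μ : Measure (Fin n → ℝ)} [SFinite μ] {J : Set (Fin m → ℝ)}
    (hb : AEStronglyMeasurable b (μ.prod (volume.restrict J))) :
    AEMeasurable (fun z : (Fin n → ℝ) × (Fin m → ℝ) =>
      ‖b z - setAvg (fun y => b (z.1, y)) J‖ₑ) (μ.prod (volume.restrict J)) := by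
  have h : AEStronglyMeasurable
      (fun z : (Fin n → ℝ) × (Fin m → ℝ) => setAvg (fun y => b (z.1, y)) J)
      (μ.prod (volume.restrict J)) :=
    (aestronglyMeasurable_setAvg_slice hb).comp_fst
  exact (hb.sub h).enorm

/-! ### Lower bound -/

lemma slice_le {n m : ℕ} {b : (Fin n → ℝ) × (Fin m → ℝ) → ℂ} (hb : LocallyIntegrable b) :
    essSup (fun x₁ : Fin n → ℝ => bmoD m (fun x₂ => b (x₁, x₂))) volume ≤ 2 * bmoRectD n m b := by
  by_cases hN : bmoRectD n m b = ⊤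
  · rw [hN, ENNReal.mul_top (by norm_num)]; exact le_top
  refine essSup_le_of_ae_le _ ?_
  have key : ∀ (k' : ℤ) (mm : Fin m → ℤ), ∀ᵐ x : Fin n → ℝ,
      oscE (fun y => b (x, y)) (dyadicCube m k' mm) ≤ 2 * bmoRectD n m b := by
    intro k' mm
    set J := dyadicCube m k' mm with hJ
    have hJ0 : volume J ≠ 0 := volume_dyadicCube_ne_zero _ _ _
    have hJt : volume J ≠ ⊤ := volume_dyadicCube_ne_top _ _ _
    have hbm : AEStronglyMeasurable b
        ((volume : Measure (Fin n → ℝ)).prod (volume.restrict J)) := by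
      have h1 : AEStronglyMeasurable b (volume.restrict (univ ×ˢ J)) :=
        hb.aestronglyMeasurable.restrict
      rwa [restrict_rect, Measure.restrict_univ] at h1
    have hFm : AEMeasurable
        (fun x : Fin n → ℝ => ∫⁻ y in J, ‖b (x, y) - setAvg (fun y => b (x, y)) J‖ₑ) volume :=
      (aemeasurable_osc hbm).lintegral_prod_right'
    have hF := ae_le_of_dyadic_avg_le n _ hFm (volume J * (2 * bmoRectD n m b))
      (ENNReal.mul_ne_top hJt (ENNReal.mul_ne_top (by norm_num) hN)) ?_
    · filter_upwards [hF] with x hx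
      rwa [oscE_le_iff _ _ hJ0 hJt]
    · intro k nn
      set I := dyadicCube n k nn with hI
      have hI0 : volume I ≠ 0 := volume_dyadicCube_ne_zero _ _ _
      have hIt : volume I ≠ ⊤ := volume_dyadicCube_ne_top _ _ _
      have hint := integrable_rect hb k nn k' mm
      have hle : oscE b (I ×ˢ J) ≤ bmoRectD n m b :=
        le_iSup_of_le k (le_iSup_of_le nn (le_iSup_of_le k' (le_iSup_of_le mm le_rfl)))
      rw [oscE_le_iff _ _ (by rw [volume_rect]; exact mul_ne_zero hI0 hJ0)
        (by rw [volume_rect]; exact ENNReal.mul_ne_top hIt hJt), volume_rect, restrict_rect] at hle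
      set c := setAvg b (I ×ˢ J)
      have hmc : AEMeasurable (fun z => ‖b z - c‖ₑ)
          ((volume.restrict I).prod (volume.restrict J)) :=
        (hint.aestronglyMeasurable.sub aestronglyMeasurable_const).enorm
      rw [lintegral_prod _ hmc] at hle
      calc ∫⁻ x in I, ∫⁻ y in J, ‖b (x, y) - setAvg (fun y => b (x, y)) J‖ₑ
          ≤ ∫⁻ x in I, 2 * ∫⁻ y in J, ‖b (x, y) - c‖ₑ := by
            refine lintegral_mono_ae ?_
            filter_upwards [hint.prod_right_ae] with x hx
            exact lintegral_sub_setAvg_le _ J hJ0 hJt hx c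
        _ = 2 * ∫⁻ x in I, ∫⁻ y in J, ‖b (x, y) - c‖ₑ := lintegral_const_mul' _ _ (by norm_num)
        _ ≤ 2 * (volume I * volume J * bmoRectD n m b) := by gcongr
        _ = volume J * (2 * bmoRectD n m b) * volume I := by ring
  filter_upwards [ae_all_iff.2 fun k' => ae_all_iff.2 fun mm => key k' mm] with x hx
  exact iSup_le fun k' => iSup_le fun mm => hx k' mm

/-! ### Symmetry -/

lemma oscE_swap {n m : ℕ} (b : (Fin n → ℝ) × (Fin m → ℝ) → ℂ)
    (I : Set (Fin n → ℝ)) (J : Set (Fin m → ℝ)) :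
    oscE (fun z : (Fin m → ℝ) × (Fin n → ℝ) => b z.swap) (J ×ˢ I) = oscE b (I ×ˢ J) := by
  have hv : volume (J ×ˢ I) = volume (I ×ˢ J) := by
    rw [volume_rect, volume_rect, mul_comm]
  have ha : setAvg (fun z : (Fin m → ℝ) × (Fin n → ℝ) => b z.swap) (J ×ˢ I)
      = setAvg b (I ×ˢ J) := by
    unfold setAvg
    rw [hv]
    congr 1
    exact setIntegral_prod_swap I J b
  rw [oscE_eq, oscE_eq, hv, ha, restrict_rect, restrict_rect]
  congr 1
  exact lintegral_prod_swap (fun z => ‖b z - setAvg b (I ×ˢ J)‖ₑ)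

lemma bmoRectD_swap {n m : ℕ} (b : (Fin n → ℝ) × (Fin m → ℝ) → ℂ) :
    bmoRectD m n (fun z => b z.swap) ≤ bmoRectD n m b := by
  refine iSup_le fun k' => iSup_le fun mm => iSup_le fun k => iSup_le fun nn => ?_
  rw [oscE_swap]
  exact le_iSup_of_le k (le_iSup_of_le nn (le_iSup_of_le k' (le_iSup_of_le mm le_rfl)))

lemma locallyIntegrable_swap {n m : ℕ} {b : (Fin n → ℝ) × (Fin m → ℝ) → ℂ}
    (hb : LocallyIntegrable b) :
    LocallyIntegrable (fun z : (Fin m → ℝ) × (Fin n → ℝ) => b z.swap) := by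
  have hmp : MeasurePreserving (Prod.swap : (Fin m → ℝ) × (Fin n → ℝ) → _) volume volume :=
    Measure.measurePreserving_swap
  intro z
  obtain ⟨U, hU, hbU⟩ := hb z.swap
  refine ⟨Prod.swap ⁻¹' U, continuous_swap.continuousAt hU, ?_⟩
  exact (hmp.integrableOn_comp_preimage MeasurableEquiv.prodComm.measurableEmbedding).2 hbU

/-! ### Upper bound -/

lemma lintegral_osc_le {n m : ℕ} {b : (Fin n → ℝ) × (Fin m → ℝ) → ℂ} (I : Set (Fin n → ℝ))
    (k' : ℤ) (mm : Fin m → ℤ) :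
    ∫⁻ x in I, ∫⁻ y in dyadicCube m k' mm,
        ‖b (x, y) - setAvg (fun y => b (x, y)) (dyadicCube m k' mm)‖ₑ
      ≤ volume I * volume (dyadicCube m k' mm) *
        essSup (fun x₁ : Fin n → ℝ => bmoD m (fun x₂ => b (x₁, x₂))) volume := by
  set A := essSup (fun x₁ : Fin n → ℝ => bmoD m (fun x₂ => b (x₁, x₂))) volume with hA
  have h : ∀ᵐ x ∂(volume.restrict I), ∫⁻ y in dyadicCube m k' mm,
        ‖b (x, y) - setAvg (fun y => b (x, y)) (dyadicCube m k' mm)‖ₑ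
        ≤ volume (dyadicCube m k' mm) * A := by
    refine ae_restrict_of_ae ?_
    filter_upwards [ENNReal.ae_le_essSup
      (fun x₁ : Fin n → ℝ => bmoD m (fun x₂ => b (x₁, x₂)))] with x hx
    rw [← oscE_le_iff _ _ (volume_dyadicCube_ne_zero _ _ _) (volume_dyadicCube_ne_top _ _ _)]
    refine le_trans ?_ hx
    unfold bmoD
    exact le_iSup_of_le k' (le_iSup_of_le mm le_rfl)
  refine (lintegral_mono_ae h).trans ?_
  rw [setLIntegral_const]
  exact le_of_eq (by ring)

lemma rect_le {n m : ℕ} {b : (Fin n → ℝ) × (Fin m → ℝ) → ℂ} (hb : LocallyIntegrable b) :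
    bmoRectD n m b ≤ essSup (fun x₁ : Fin n → ℝ => bmoD m (fun x₂ => b (x₁, x₂))) volume
      + essSup (fun x₂ : Fin m → ℝ => bmoD n (fun x₁ => b (x₁, x₂))) volume := by
  refine iSup_le fun k => iSup_le fun nn => iSup_le fun k' => iSup_le fun mm => ?_
  have hA := lintegral_osc_le (b := b) (dyadicCube n k nn) k' mm
  have hB := lintegral_osc_le (b := fun z : (Fin m → ℝ) × (Fin n → ℝ) => b z.swap)
    (dyadicCube m k' mm) k nn
  have hint := integrable_rect hb k nn k' mm
  have hints := integrable_rect (locallyIntegrable_swap hb) k' mm k nn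
  have hI0 : volume (dyadicCube n k nn) ≠ 0 := volume_dyadicCube_ne_zero _ _ _
  have hIt : volume (dyadicCube n k nn) ≠ ⊤ := volume_dyadicCube_ne_top _ _ _
  have hJ0 : volume (dyadicCube m k' mm) ≠ 0 := volume_dyadicCube_ne_zero _ _ _
  have hJt : volume (dyadicCube m k' mm) ≠ ⊤ := volume_dyadicCube_ne_top _ _ _
  simp only [Prod.swap_prod_mk] at hB
  set A := essSup (fun x₁ : Fin n → ℝ => bmoD m (fun x₂ => b (x₁, x₂))) volume
  set B := essSup (fun x₂ : Fin m → ℝ => bmoD n (fun x₁ => b (x₁, x₂))) volume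
  set I := dyadicCube n k nn
  set J := dyadicCube m k' mm
  set c := setAvg b (I ×ˢ J) with hc
  set a : (Fin n → ℝ) → ℂ := fun x => setAvg (fun y => b (x, y)) J with ha
  set e : (Fin m → ℝ) → ℂ := fun y => setAvg (fun x => b (x, y)) I with he
  -- `c` is the average of `e`
  have hce : c = setAvg e J := by
    have h1 : ∫ z in I ×ˢ J, b z = ∫ y in J, ∫ x in I, b (x, y) := by
      rw [restrict_rect, integral_prod_symm _ hint]
    rw [hc, setAvg, h1, volume_rect, he]
    simp only [setAvg]
    rw [integral_smul, smul_smul, ENNReal.toReal_mul, mul_inv, mul_comm]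
  have heint : IntegrableOn e J := by
    have := hint.integral_prod_right
    exact this.smul ((volume I).toReal⁻¹)
  have hmB : AEMeasurable (fun z : (Fin m → ℝ) × (Fin n → ℝ) => ‖b z.swap - e z.1‖ₑ)
      ((volume.restrict J).prod (volume.restrict I)) :=
    aemeasurable_osc hints.aestronglyMeasurable
  have hac : ∫⁻ x in I, ‖a x - c‖ₑ ≤ volume I * B := by
    have h1 : ∀ᵐ x ∂(volume.restrict I),
        ‖a x - c‖ₑ ≤ (volume J)⁻¹ * ∫⁻ y in J, ‖b (x, y) - e y‖ₑ := by
      filter_upwards [hint.prod_right_ae] with x hx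
      have h2 : a x - c = setAvg (fun y => b (x, y) - e y) J - 0 := by
        rw [hce, ha]
        simp only [setAvg]
        rw [sub_zero, integral_sub hx heint, smul_sub]
      rw [h2]
      refine (setAvg_sub_enorm_le _ J hJ0 hJt (hx.sub heint) 0).trans ?_
      simp
    calc ∫⁻ x in I, ‖a x - c‖ₑ
        ≤ ∫⁻ x in I, (volume J)⁻¹ * ∫⁻ y in J, ‖b (x, y) - e y‖ₑ := lintegral_mono_ae h1
      _ = (volume J)⁻¹ * ∫⁻ x in I, ∫⁻ y in J, ‖b (x, y) - e y‖ₑ :=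
          lintegral_const_mul' _ _ (ENNReal.inv_ne_top.2 hJ0)
      _ = (volume J)⁻¹ * ∫⁻ y in J, ∫⁻ x in I, ‖b (x, y) - e y‖ₑ := by
          congr 1
          have := lintegral_prod_symm _ hmB
          rw [lintegral_prod _ hmB] at this
          exact this.symm
      _ ≤ (volume J)⁻¹ * (volume J * volume I * B) := by gcongr
      _ = volume I * B := by
          rw [mul_assoc, ← mul_assoc, ENNReal.inv_mul_cancel hJ0 hJt, one_mul]
  rw [oscE_le_iff _ _ (by rw [volume_rect]; exact mul_ne_zero hI0 hJ0)
    (by rw [volume_rect]; exact ENNReal.mul_ne_top hIt hJt), volume_rect, restrict_rect, ← hc]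
  have hmc : AEMeasurable (fun z => ‖b z - c‖ₑ)
      ((volume.restrict I).prod (volume.restrict J)) :=
    (hint.aestronglyMeasurable.sub aestronglyMeasurable_const).enorm
  rw [lintegral_prod _ hmc]
  have hmA : AEMeasurable (fun x => ‖a x - c‖ₑ) (volume.restrict I) :=
    ((aestronglyMeasurable_setAvg_slice hint.aestronglyMeasurable).sub
      aestronglyMeasurable_const).enorm
  calc ∫⁻ x in I, ∫⁻ y in J, ‖b (x, y) - c‖ₑ
      ≤ ∫⁻ x in I, ((∫⁻ y in J, ‖b (x, y) - a x‖ₑ) + ‖a x - c‖ₑ * volume J) := by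
        refine lintegral_mono fun x => ?_
        rw [← setLIntegral_const, ← lintegral_add_right _ measurable_const]
        refine lintegral_mono fun y => ?_
        have : b (x, y) - c = (b (x, y) - a x) + (a x - c) := by ring
        rw [this]
        exact enorm_add_le _ _
    _ = (∫⁻ x in I, ∫⁻ y in J, ‖b (x, y) - a x‖ₑ) + (∫⁻ x in I, ‖a x - c‖ₑ) * volume J := by
        rw [lintegral_add_right' _ (hmA.mul_const _), lintegral_mul_const' _ _ hJt]
    _ ≤ volume I * volume J * A + (volume I * B) * volume J := by gcongr
    _ = volume I * volume J * (A + B) := by ring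

/-- The little BMO norm `‖b‖_{bmo(𝒟)}` is comparable, up to dimensional constants, to
`max(ess sup_{x₁} ‖b(x₁,·)‖_{BMO(𝒟ᵐ)}, ess sup_{x₂} ‖b(·,x₂)‖_{BMO(𝒟ⁿ)})`. -/
theorem bmoRectD_comparable_sliceNorms (n m : ℕ) :
    ∃ c C : ℝ≥0∞, 0 < c ∧ C ≠ ⊤ ∧
      ∀ b : (Fin n → ℝ) × (Fin m → ℝ) → ℂ, LocallyIntegrable b →
        c * max (essSup (fun x₁ : Fin n → ℝ => bmoD m (fun x₂ => b (x₁, x₂))) volume)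
              (essSup (fun x₂ : Fin m → ℝ => bmoD n (fun x₁ => b (x₁, x₂))) volume)
            ≤ bmoRectD n m b ∧
        bmoRectD n m b ≤
          C * max (essSup (fun x₁ : Fin n → ℝ => bmoD m (fun x₂ => b (x₁, x₂))) volume)
              (essSup (fun x₂ : Fin m → ℝ => bmoD n (fun x₁ => b (x₁, x₂))) volume) := by
  refine ⟨2⁻¹, 2, by norm_num, by norm_num, fun b hb => ⟨?_, ?_⟩⟩
  · rw [ENNReal.inv_mul_le_iff (by norm_num) (by norm_num)]
    refine max_le (slice_le hb) ?_
    refine (slice_le (locallyIntegrable_swap hb)).trans ?_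
    gcongr
    exact bmoRectD_swap b
  · refine (rect_le hb).trans ?_
    rw [two_mul]
    exact add_le_add (le_max_left _ _) (le_max_right _ _)

end
end

section
/- A weight w on ℝⁿ×ℝᵐ belongs to bi-parameter A_p if and only if the slices are uniformly in one-parameter A_p: [w]_{A_p(ℝⁿ×ℝᵐ)} < ∞ iff max(ess sup_{x₁}[w(x₁,·)]_{A_p(ℝᵐ)}, ess sup_{x₂}[w(·,x₂)]_{A_p(ℝⁿ)}) < ∞; moreover the maximum of slice constants is at most [w]_{A_p(ℝⁿ×ℝᵐ)}. -/
open MeasureTheory Set Filter Topology ENNReal NNReal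

noncomputable section

/-- The axis-parallel cube with corner `c` and side length `l` in `ℝᵈ`. -/
def cube (d : ℕ) (c : Fin d → ℝ) (l : ℝ) : Set (Fin d → ℝ) :=
  {x | ∀ i, c i ≤ x i ∧ x i < c i + l}

/-- The one-parameter `A_p` constant of a weight on `ℝᵈ`:
`sup_Q ⟨w⟩_Q ⟨w^{1-p'}⟩_Q^{p-1}` over all cubes `Q`. -/
def apCube (d : ℕ) (p : ℝ) (w : (Fin d → ℝ) → ℝ≥0∞) : ℝ≥0∞ :=
  ⨆ (c : Fin d → ℝ) (l : ℝ) (_ : 0 < l),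
    ((volume (cube d c l))⁻¹ * ∫⁻ x in cube d c l, w x) *
      ((volume (cube d c l))⁻¹ * ∫⁻ x in cube d c l, w x ^ ((1:ℝ) - p/(p-1))) ^ (p-1)

/-- The bi-parameter `A_p` constant of a weight on `ℝⁿ × ℝᵐ`:
`sup_R ⟨w⟩_R ⟨w^{1-p'}⟩_R^{p-1}` over all rectangles `R = I × J` with `I, J` cubes. -/
def apRect (n m : ℕ) (p : ℝ) (w : (Fin n → ℝ) × (Fin m → ℝ) → ℝ≥0∞) : ℝ≥0∞ :=
  ⨆ (c₁ : Fin n → ℝ) (l₁ : ℝ) (_ : 0 < l₁) (c₂ : Fin m → ℝ) (l₂ : ℝ) (_ : 0 < l₂),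
    ((volume (cube n c₁ l₁ ×ˢ cube m c₂ l₂))⁻¹ *
        ∫⁻ x in cube n c₁ l₁ ×ˢ cube m c₂ l₂, w x) *
      ((volume (cube n c₁ l₁ ×ˢ cube m c₂ l₂))⁻¹ *
          ∫⁻ x in cube n c₁ l₁ ×ˢ cube m c₂ l₂, w x ^ ((1:ℝ) - p/(p-1))) ^ (p-1)

theorem vol_cube (d : ℕ) (c : Fin d → ℝ) (l : ℝ) : volume (cube d c l) = ENNReal.ofReal l ^ d := by
  have : cube d c l = Set.pi univ (fun i => Ico (c i) (c i + l)) := by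
    ext x; simp [cube]
  rw [this, volume_pi_pi]; simp

theorem meas_cube (d : ℕ) (c : Fin d → ℝ) (l : ℝ) : MeasurableSet (cube d c l) := by
  have : cube d c l = Set.pi univ (fun i => Ico (c i) (c i + l)) := by
    ext x; simp [cube]
  rw [this]
  exact MeasurableSet.univ_pi fun i => measurableSet_Ico

theorem vol_cube_ne_zero (d : ℕ) (c : Fin d → ℝ) (l : ℝ) (hl : 0 < l) : volume (cube d c l) ≠ 0 := by
  rw [vol_cube]; simp [hl]

theorem vol_cube_ne_top (d : ℕ) (c : Fin d → ℝ) (l : ℝ) : volume (cube d c l) ≠ ⊤ := by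
  rw [vol_cube]; simp

theorem cube_ae_ball (d : ℕ) (x : Fin d → ℝ) (r : ℝ) (hr : 0 < r) :
    (cube d (fun i => x i - r) (2 * r) : Set (Fin d → ℝ)) =ᵐ[volume] Metric.closedBall x r := by
  have : cube d (fun i => x i - r) (2 * r) = Set.pi univ (fun i => Ico (x i - r) (x i + r)) := by
    ext y; simp only [cube, Set.mem_ofPred_eq, Set.mem_pi, mem_univ, mem_Ico, forall_true_left]
    refine forall_congr' fun i => ?_
    rw [show x i - r + 2 * r = x i + r by ring]
  rw [this, closedBall_pi x hr.le]
  simp only [Real.closedBall_eq_Icc]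
  exact Measure.pi_Ico_ae_eq_pi_Icc (f := fun i => x i - r) (g := fun i => x i + r)

theorem norm_iff (p : ℝ) (hp : 1 < p) (V a b K : ℝ≥0∞) (hV : V ≠ 0) (hV' : V ≠ ⊤) :
    (V⁻¹ * a) * (V⁻¹ * b) ^ (p-1) ≤ K ↔ a * b ^ (p-1) ≤ K * V ^ p := by
  have h1 : (V⁻¹ * a) * (V⁻¹ * b) ^ (p-1) = (a * b ^ (p-1)) / V ^ p := by
    rw [ENNReal.mul_rpow_of_nonneg _ _ (by linarith), ENNReal.div_eq_inv_mul, ← ENNReal.inv_rpow]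
    have : V⁻¹ ^ p = V⁻¹ * V⁻¹ ^ (p-1) := by
      conv_rhs => rw [← ENNReal.rpow_one V⁻¹, ← ENNReal.rpow_mul, one_mul]
      rw [← ENNReal.rpow_add _ _ (by simpa using hV') (by simpa using hV)]
      ring_nf
    rw [this]; ring
  rw [h1, ENNReal.div_le_iff]
  · simp [ENNReal.rpow_eq_zero_iff, hV, hV']
  · simp [ENNReal.rpow_eq_top_iff, hV, hV']

theorem holder_ap {X : Type*} [MeasurableSpace X] (μ : Measure X) (p : ℝ) (hp : 1 < p)
    (S w : X → ℝ≥0∞) (hS : Measurable S) (hw : Measurable w) (hpos : ∀ᵐ x ∂μ, 0 < w x ∧ w x < ⊤) :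
    (∫⁻ x, S x ∂μ) ^ p ≤ (∫⁻ x, S x ^ p * w x ∂μ) * (∫⁻ x, w x ^ ((1:ℝ) - p/(p-1)) ∂μ) ^ (p-1) := by
  have hp0 : 0 < p := by linarith
  have hp1 : 0 < p - 1 := by linarith
  have hc : p.HolderConjugate (p/(p-1)) := Real.HolderConjugate.conjExponent hp
  have h := ENNReal.lintegral_mul_le_Lp_mul_Lq μ hc (f := fun x => S x * w x ^ (1/p))
    (g := fun x => w x ^ (-(1/p))) (by fun_prop) (by fun_prop)
  have e1 : ∫⁻ x, ((fun x => S x * w x ^ (1/p)) * (fun x => w x ^ (-(1/p)))) x ∂μ = ∫⁻ x, S x ∂μ := by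
    refine lintegral_congr_ae ?_
    filter_upwards [hpos] with x hx
    simp only [Pi.mul_apply]
    rw [mul_assoc, ← ENNReal.rpow_add _ _ hx.1.ne' hx.2.ne]
    simp
  have e2 : ∀ x, (S x * w x ^ (1/p)) ^ p = S x ^ p * w x := by
    intro x
    rw [ENNReal.mul_rpow_of_nonneg _ _ hp0.le, ← ENNReal.rpow_mul, one_div_mul_cancel hp0.ne',
      ENNReal.rpow_one]
  have e3 : ∀ x, (w x ^ (-(1/p))) ^ (p/(p-1)) = w x ^ ((1:ℝ) - p/(p-1)) := by
    intro x
    rw [← ENNReal.rpow_mul]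
    congr 1
    field_simp
    ring
  rw [e1] at h
  simp only [e2, e3] at h
  calc _ ≤ _ := ENNReal.rpow_le_rpow h hp0.le
    _ = _ := by
      rw [ENNReal.mul_rpow_of_nonneg _ _ hp0.le, ← ENNReal.rpow_mul, ← ENNReal.rpow_mul,
        one_div_mul_cancel hp0.ne', ENNReal.rpow_one]
      congr 2
      field_simp

theorem core_dir2 {X Y : Type*} [MeasurableSpace X] [MeasurableSpace Y] (μ : Measure X)
    (ν : Measure Y) [IsFiniteMeasure μ] [IsFiniteMeasure ν] (p : ℝ) (hp : 1 < p)
    (w : X × Y → ℝ≥0∞) (hw : Measurable w)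
    (hpos : ∀ᵐ y ∂ν, ∀ᵐ x ∂μ, 0 < w (x, y) ∧ w (x, y) < ⊤) (A B : ℝ≥0∞)
    (hA : ∀ᵐ x ∂μ, (∫⁻ y, w (x, y) ∂ν) * (∫⁻ y, w (x, y) ^ ((1:ℝ) - p/(p-1)) ∂ν) ^ (p-1) ≤ A)
    (hB : ∀ᵐ y ∂ν, (∫⁻ x, w (x, y) ∂μ) * (∫⁻ x, w (x, y) ^ ((1:ℝ) - p/(p-1)) ∂μ) ^ (p-1) ≤ B)
    (hfin : ∫⁻ x, ∫⁻ y, w (x, y) ∂ν ∂μ ≠ ⊤) :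
    (∫⁻ x, ∫⁻ y, w (x, y) ∂ν ∂μ) *
      (∫⁻ x, ∫⁻ y, w (x, y) ^ ((1:ℝ) - p/(p-1)) ∂ν ∂μ) ^ (p-1) ≤ A * B := by
  have hp1 : 0 < p - 1 := by linarith
  set S : X → ℝ≥0∞ := fun x => ∫⁻ y, w (x, y) ^ ((1:ℝ) - p/(p-1)) ∂ν with hSdef
  have hS : Measurable S := by
    have : Measurable fun z : X × Y => w z ^ ((1:ℝ) - p/(p-1)) := by fun_prop
    exact this.lintegral_prod_right'
  have key : ∀ N : ℕ, (∫⁻ x, ∫⁻ y, w (x, y) ∂ν ∂μ) * (∫⁻ x, min (S x) N ∂μ) ^ (p-1) ≤ A * B := by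
    intro N
    set T : X → ℝ≥0∞ := fun x => min (S x) N with hT
    have hTm : Measurable T := by fun_prop
    set t := ∫⁻ x, T x ∂μ with ht
    have htop : t ≠ ⊤ := by
      refine ne_top_of_le_ne_top (b := (N : ℝ≥0∞) * μ univ) (ENNReal.mul_ne_top (by simp) (by simp)) ?_
      calc t ≤ ∫⁻ x, (N : ℝ≥0∞) ∂μ := lintegral_mono fun x => min_le_right _ _
        _ = _ := by simp
    rcases eq_or_ne t 0 with h0 | h0
    · rw [h0, ENNReal.zero_rpow_of_pos hp1]; simp
    have h1 : ∀ᵐ y ∂ν, t ^ p * (∫⁻ x, w (x, y) ∂μ) ≤ B * ∫⁻ x, T x ^ p * w (x, y) ∂μ := by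
      filter_upwards [hpos, hB] with y hy hy2
      have := holder_ap μ p hp T (fun x => w (x, y)) hTm (by fun_prop) hy
      calc _ ≤ _ := mul_le_mul_left this _
        _ = ((∫⁻ x, w (x, y) ∂μ) * (∫⁻ x, w (x, y) ^ ((1:ℝ) - p/(p-1)) ∂μ) ^ (p-1)) *
            ∫⁻ x, T x ^ p * w (x, y) ∂μ := by ring
        _ ≤ _ := mul_le_mul_left hy2 _
    have h2 : t ^ p * (∫⁻ x, ∫⁻ y, w (x, y) ∂ν ∂μ) ≤ B * (A * t) := by
      calc t ^ p * (∫⁻ x, ∫⁻ y, w (x, y) ∂ν ∂μ) = ∫⁻ y, t ^ p * ∫⁻ x, w (x, y) ∂μ ∂ν := by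
            rw [lintegral_lintegral_swap (by exact hw.aemeasurable), lintegral_const_mul]
            exact hw.lintegral_prod_left'
        _ ≤ ∫⁻ y, B * ∫⁻ x, T x ^ p * w (x, y) ∂μ ∂ν := lintegral_mono_ae h1
        _ = B * ∫⁻ x, T x ^ p * ∫⁻ y, w (x, y) ∂ν ∂μ := by
            have hm : Measurable fun z : X × Y => T z.1 ^ p * w z := by fun_prop
            rw [lintegral_const_mul _ hm.lintegral_prod_left',
              ← lintegral_lintegral_swap (f := fun x y => T x ^ p * w (x, y)) hm.aemeasurable]
            congr 1
            refine lintegral_congr fun x => ?_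
            rw [lintegral_const_mul]
            fun_prop
        _ ≤ B * ∫⁻ x, A * T x ∂μ := by
            refine mul_le_mul_right (lintegral_mono_ae ?_) _
            filter_upwards [hA] with x hx
            have : T x ^ p ≤ T x * S x ^ (p-1) := by
              calc T x ^ p = T x ^ (1 + (p-1)) := by ring_nf
                _ = T x * T x ^ (p-1) := by
                  rw [ENNReal.rpow_add_of_nonneg _ _ (by norm_num) hp1.le, ENNReal.rpow_one]
                _ ≤ _ := mul_le_mul_right (ENNReal.rpow_le_rpow (min_le_left _ _) hp1.le) _
            calc _ ≤ _ := mul_le_mul_left this _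
              _ = ((∫⁻ y, w (x, y) ∂ν) * S x ^ (p-1)) * T x := by ring
              _ ≤ _ := mul_le_mul_left hx _
        _ = _ := by rw [lintegral_const_mul _ hTm]
    have h3 : t ^ p = t * t ^ (p-1) := by
      calc t ^ p = t ^ (1 + (p-1)) := by ring_nf
        _ = _ := by rw [ENNReal.rpow_add_of_nonneg _ _ (by norm_num) hp1.le, ENNReal.rpow_one]
    rw [← ENNReal.mul_le_mul_iff_right h0 htop]
    calc _ = t ^ p * (∫⁻ x, ∫⁻ y, w (x, y) ∂ν ∂μ) := by rw [h3]; ring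
      _ ≤ _ := h2
      _ = _ := by ring
  have hlim : Tendsto (fun N : ℕ => ∫⁻ x, min (S x) N ∂μ) atTop (𝓝 (∫⁻ x, S x ∂μ)) := by
    refine lintegral_tendsto_of_tendsto_of_monotone (fun N => by fun_prop) ?_ ?_
    · refine ae_of_all _ fun x a b hab => min_le_min_left _ (by exact_mod_cast hab)
    · refine ae_of_all _ fun x => ?_
      have := (tendsto_const_nhds (x := S x)).min ENNReal.tendsto_nat_nhds_top
      simpa using this
  refine le_of_tendsto' (ENNReal.Tendsto.const_mul
    ((ENNReal.continuous_rpow_const.tendsto _).comp hlim) (Or.inr hfin)) key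

theorem dir1 (n m : ℕ) (p : ℝ) (hp : 1 < p) (w : (Fin n → ℝ) × (Fin m → ℝ) → ℝ≥0∞)
    (hw : Measurable w) (K : ℝ≥0∞) (hK : K ≠ ⊤)
    (hF : ∀ (c₁ : Fin n → ℝ) (l₁ : ℝ) (c₂ : Fin m → ℝ) (l₂ : ℝ), 0 < l₁ → 0 < l₂ →
      (∫⁻ x in cube n c₁ l₁, ∫⁻ y in cube m c₂ l₂, w (x, y)) < ⊤)
    (hG : ∀ (c₁ : Fin n → ℝ) (l₁ : ℝ) (c₂ : Fin m → ℝ) (l₂ : ℝ), 0 < l₁ → 0 < l₂ →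
      (∫⁻ x in cube n c₁ l₁, ∫⁻ y in cube m c₂ l₂, w (x, y) ^ ((1:ℝ) - p/(p-1))) < ⊤)
    (H : ∀ (c₁ : Fin n → ℝ) (l₁ : ℝ) (c₂ : Fin m → ℝ) (l₂ : ℝ), 0 < l₁ → 0 < l₂ →
      (∫⁻ x in cube n c₁ l₁, ∫⁻ y in cube m c₂ l₂, w (x, y)) *
      (∫⁻ x in cube n c₁ l₁, ∫⁻ y in cube m c₂ l₂, w (x, y) ^ ((1:ℝ) - p/(p-1))) ^ (p-1)
      ≤ K * (volume (cube n c₁ l₁) * volume (cube m c₂ l₂)) ^ p) :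
    ∀ᵐ x : Fin n → ℝ, apCube m p (fun y => w (x, y)) ≤ K := by
  have hp0 : 0 < p := by linarith
  have hp1 : 0 < p - 1 := by linarith
  have leb : ∀ f : (Fin n → ℝ) → ℝ≥0∞, Measurable f →
      (∀ c l, 0 < l → ∫⁻ x in cube n c l, f x < ⊤) →
      ∀ᵐ x : Fin n → ℝ, f x < ⊤ ∧ Tendsto (fun r : ℝ =>
        (volume (cube n (fun i => x i - r) (2 * r)))⁻¹ * ∫⁻ y in cube n (fun i => x i - r) (2 * r), f y)
        (𝓝[>] 0) (𝓝 (f x)) := by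
    intro f hf hfin
    have hball : ∀ x r, 0 < r → (volume.withDensity f) (Metric.closedBall x r) =
        ∫⁻ y in cube n (fun i => x i - r) (2 * r), f y := by
      intro x r hr
      rw [withDensity_apply _ Metric.isClosed_closedBall.measurableSet]
      exact setLIntegral_congr (cube_ae_ball n x r hr).symm
    have : IsLocallyFiniteMeasure (volume.withDensity f) := by
      refine ⟨fun x => ⟨Metric.closedBall x 1, Metric.closedBall_mem_nhds x one_pos, ?_⟩⟩
      rw [hball x 1 one_pos]
      exact hfin _ _ (by norm_num)
    have h1 := Besicovitch.ae_tendsto_rnDeriv (volume.withDensity f) (volume : Measure (Fin n → ℝ))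
    have h2 := Measure.rnDeriv_withDensity (volume : Measure (Fin n → ℝ)) hf
    have h3 := Measure.rnDeriv_lt_top (volume.withDensity f) (volume : Measure (Fin n → ℝ))
    filter_upwards [h1, h2, h3] with x hx1 hx2 hx3
    rw [hx2] at hx1 hx3
    refine ⟨hx3, hx1.congr' ?_⟩
    filter_upwards [self_mem_nhdsWithin] with r hr
    rw [hball x r hr, measure_congr (cube_ae_ball n x r hr), ENNReal.div_eq_inv_mul]
  have rat : ∀ᵐ x : Fin n → ℝ, ∀ (c : Fin m → ℚ) (l : ℚ), 0 < l →
      (∫⁻ y in cube m (fun i => (c i : ℝ)) l, w (x, y)) *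
      (∫⁻ y in cube m (fun i => (c i : ℝ)) l, w (x, y) ^ ((1:ℝ) - p/(p-1))) ^ (p-1)
      ≤ K * volume (cube m (fun i => (c i : ℝ)) l) ^ p := by
    rw [ae_all_iff]; intro c
    rw [ae_all_iff]; intro l
    by_cases hl : 0 < l
    swap
    · exact ae_of_all _ fun x h => absurd h hl
    have hl' : (0:ℝ) < l := by exact_mod_cast hl
    have hσ : Measurable fun z : (Fin n → ℝ) × (Fin m → ℝ) => w z ^ ((1:ℝ) - p/(p-1)) := by fun_prop
    filter_upwards [leb _ (hw.lintegral_prod_right' (ν := volume.restrict (cube m (fun i => (c i : ℝ)) l)))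
        (fun c₁ l₁ h => hF c₁ l₁ _ _ h hl'),
      leb _ (hσ.lintegral_prod_right' (ν := volume.restrict (cube m (fun i => (c i : ℝ)) l)))
        (fun c₁ l₁ h => hG c₁ l₁ _ _ h hl')] with x hx1 hx2 _
    have := ENNReal.Tendsto.mul hx1.2 (Or.inr ?_) ((ENNReal.continuous_rpow_const (y := p-1)).tendsto _ |>.comp hx2.2) (Or.inr hx1.1.ne)
    · refine le_of_tendsto this ?_
      filter_upwards [self_mem_nhdsWithin] with r hr
      have hr' : 0 < 2 * r := mul_pos two_pos hr
      simp only [Function.comp]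
      rw [norm_iff p hp _ _ _ _ (vol_cube_ne_zero _ _ _ hr') (vol_cube_ne_top _ _ _)]
      refine (H _ _ _ _ hr' hl').trans (le_of_eq ?_)
      rw [ENNReal.mul_rpow_of_nonneg _ _ hp0.le]; ring
    · exact ENNReal.rpow_ne_top_of_nonneg hp1.le hx2.1.ne
  filter_upwards [rat] with x hx
  refine iSup_le fun c => iSup_le fun l => iSup_le fun hl => ?_
  rw [norm_iff p hp _ _ _ _ (vol_cube_ne_zero _ _ _ hl) (vol_cube_ne_top _ _ _), vol_cube]
  have hcont : Tendsto (fun s : ℝ => K * (ENNReal.ofReal s ^ m) ^ p) (𝓝[>] l)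
      (𝓝 (K * (ENNReal.ofReal l ^ m) ^ p)) := by
    refine ENNReal.Tendsto.const_mul ?_ (Or.inr hK)
    refine (ENNReal.continuous_rpow_const.tendsto _).comp ?_
    refine ((ENNReal.continuous_pow m).tendsto _).comp ?_
    exact (ENNReal.continuous_ofReal.tendsto l).mono_left nhdsWithin_le_nhds
  refine ge_of_tendsto hcont ?_
  filter_upwards [self_mem_nhdsWithin] with s hs
  obtain ⟨l', h1, h2⟩ := exists_rat_btwn (show l < s from hs)
  have : ∀ i, ∃ q : ℚ, c i - (l' - l) < q ∧ (q : ℝ) < c i := fun i => exists_rat_btwn (by linarith)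
  choose c' hc1 hc2 using this
  have hsub : cube m c l ⊆ cube m (fun i => (c' i : ℝ)) l' := by
    intro y hy i
    have := hy i
    have := hc1 i
    have := hc2 i
    constructor <;> linarith
  have hl' : 0 < l' := by
    have : (0:ℝ) < l' := by linarith
    exact_mod_cast this
  calc _ ≤ _ := mul_le_mul' (lintegral_mono_set hsub)
        (ENNReal.rpow_le_rpow (lintegral_mono_set hsub) hp1.le)
    _ ≤ _ := hx c' l' hl'
    _ ≤ _ := by
      rw [vol_cube]
      gcongr

theorem setLIntegral_prod_meas {n m : ℕ} (f : (Fin n → ℝ) × (Fin m → ℝ) → ℝ≥0∞) (hf : Measurable f)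
    (I : Set (Fin n → ℝ)) (J : Set (Fin m → ℝ)) :
    ∫⁻ x in I ×ˢ J, f x = ∫⁻ x in I, ∫⁻ y in J, f (x, y) := by
  rw [Measure.volume_eq_prod, ← Measure.prod_restrict, lintegral_prod _ hf.aemeasurable]

/-- A weight `w` on `ℝⁿ × ℝᵐ` is in bi-parameter `A_p` iff its slices are uniformly in
one-parameter `A_p`; moreover the maximum of the essential suprema of the slice constants is
dominated by `[w]_{A_p(ℝⁿ×ℝᵐ)}`. -/
theorem apRect_finite_iff_slices (n m : ℕ) (p : ℝ) (hp : 1 < p)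
    (w : (Fin n → ℝ) × (Fin m → ℝ) → ℝ≥0∞) (hw : Measurable w)
    (hpos : ∀ᵐ x ∂volume, 0 < w x ∧ w x < ⊤)
    (hloc : ∀ (c₁ : Fin n → ℝ) (l₁ : ℝ) (c₂ : Fin m → ℝ) (l₂ : ℝ),
      (∫⁻ x in cube n c₁ l₁ ×ˢ cube m c₂ l₂, w x) < ⊤) :
    (apRect n m p w < ⊤ ↔
      max (essSup (fun x₁ : Fin n → ℝ => apCube m p (fun x₂ => w (x₁, x₂))) volume)
          (essSup (fun x₂ : Fin m → ℝ => apCube n p (fun x₁ => w (x₁, x₂))) volume) < ⊤) ∧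
    max (essSup (fun x₁ : Fin n → ℝ => apCube m p (fun x₂ => w (x₁, x₂))) volume)
        (essSup (fun x₂ : Fin m → ℝ => apCube n p (fun x₁ => w (x₁, x₂))) volume)
      ≤ apRect n m p w := by
  have hp1 : 0 < p - 1 := by linarith
  have hσ : Measurable fun z : (Fin n → ℝ) × (Fin m → ℝ) => w z ^ ((1:ℝ) - p/(p-1)) := by fun_prop
  have hvol : ∀ c₁ l₁ c₂ l₂, volume (cube n c₁ l₁ ×ˢ cube m c₂ l₂) =
      volume (cube n c₁ l₁) * volume (cube m c₂ l₂) := fun c₁ l₁ c₂ l₂ => by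
    rw [Measure.volume_eq_prod, Measure.prod_prod]
  have hv0 : ∀ c₁ l₁ c₂ l₂, 0 < l₁ → 0 < l₂ →
      volume (cube n c₁ l₁) * volume (cube m c₂ l₂) ≠ 0 := fun c₁ l₁ c₂ l₂ h1 h2 =>
    mul_ne_zero (vol_cube_ne_zero _ _ _ h1) (vol_cube_ne_zero _ _ _ h2)
  have hvt : ∀ c₁ l₁ c₂ l₂,
      volume (cube n c₁ l₁) * volume (cube m c₂ l₂) ≠ ⊤ := fun c₁ l₁ c₂ l₂ =>
    ENNReal.mul_ne_top (vol_cube_ne_top _ _ _) (vol_cube_ne_top _ _ _)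
  have main : max (essSup (fun x₁ : Fin n → ℝ => apCube m p (fun x₂ => w (x₁, x₂))) volume)
        (essSup (fun x₂ : Fin m → ℝ => apCube n p (fun x₁ => w (x₁, x₂))) volume)
      ≤ apRect n m p w := by
    rcases eq_or_ne (apRect n m p w) ⊤ with ht | ht
    · rw [ht]; exact le_top
    have H0 : ∀ (c₁ : Fin n → ℝ) (l₁ : ℝ) (c₂ : Fin m → ℝ) (l₂ : ℝ), 0 < l₁ → 0 < l₂ →
      (∫⁻ x in cube n c₁ l₁ ×ˢ cube m c₂ l₂, w x) *
      (∫⁻ x in cube n c₁ l₁ ×ˢ cube m c₂ l₂, w x ^ ((1:ℝ) - p/(p-1))) ^ (p-1)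
      ≤ apRect n m p w * (volume (cube n c₁ l₁) * volume (cube m c₂ l₂)) ^ p := by
      intro c₁ l₁ c₂ l₂ h1 h2
      rw [← norm_iff p hp _ _ _ _ (hv0 _ _ _ _ h1 h2) (hvt _ _ _ _), ← hvol]
      unfold apRect
      refine le_iSup_of_le c₁ <| le_iSup_of_le l₁ <| le_iSup_of_le h1 <|
        le_iSup_of_le c₂ <| le_iSup_of_le l₂ <| le_iSup_of_le h2 le_rfl
    have hG0 : ∀ (c₁ : Fin n → ℝ) (l₁ : ℝ) (c₂ : Fin m → ℝ) (l₂ : ℝ), 0 < l₁ → 0 < l₂ →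
      (∫⁻ x in cube n c₁ l₁ ×ˢ cube m c₂ l₂, w x ^ ((1:ℝ) - p/(p-1))) < ⊤ := by
      intro c₁ l₁ c₂ l₂ h1 h2
      by_contra hcon
      rw [not_lt, top_le_iff] at hcon
      have h := H0 c₁ l₁ c₂ l₂ h1 h2
      have hne : (∫⁻ x in cube n c₁ l₁ ×ˢ cube m c₂ l₂, w x) ≠ 0 := by
        intro h0
        rw [lintegral_eq_zero_iff hw] at h0
        have hbot : ∀ᵐ x ∂(volume.restrict (cube n c₁ l₁ ×ˢ cube m c₂ l₂)), False := by
          filter_upwards [h0, ae_restrict_of_ae hpos] with x hx hx2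
          exact hx2.1.ne' hx
        rw [ae_iff] at hbot
        simp only [not_false_eq_true, ofPred_true, Measure.restrict_apply_univ] at hbot
        rw [hvol] at hbot
        exact hv0 _ _ _ _ h1 h2 hbot
      rw [hcon, ENNReal.top_rpow_of_pos hp1, ENNReal.mul_top hne, top_le_iff] at h
      exact ENNReal.mul_ne_top ht (ENNReal.rpow_ne_top_of_nonneg (by linarith) (hvt _ _ _ _)) h
    refine max_le ?_ ?_
    · refine essSup_le_of_ae_le _ (dir1 n m p hp w hw _ ht ?_ ?_ ?_)
      · intro c₁ l₁ c₂ l₂ h1 h2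
        rw [← setLIntegral_prod_meas w hw]; exact hloc _ _ _ _
      · intro c₁ l₁ c₂ l₂ h1 h2
        rw [← setLIntegral_prod_meas _ hσ]; exact hG0 _ _ _ _ h1 h2
      · intro c₁ l₁ c₂ l₂ h1 h2
        rw [← setLIntegral_prod_meas w hw, ← setLIntegral_prod_meas _ hσ]; exact H0 _ _ _ _ h1 h2
    · have sw : ∀ f : (Fin n → ℝ) × (Fin m → ℝ) → ℝ≥0∞, Measurable f → ∀ (I : Set (Fin n → ℝ))
          (J : Set (Fin m → ℝ)), ∫⁻ y in J, ∫⁻ x in I, f (x, y) = ∫⁻ z in I ×ˢ J, f z := by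
        intro f hf I J
        rw [setLIntegral_prod_meas f hf]; exact (lintegral_lintegral_swap (f := fun x y => f (x, y)) hf.aemeasurable).symm
      refine essSup_le_of_ae_le _ (dir1 m n p hp (fun z => w (z.2, z.1)) (by fun_prop) _ ht ?_ ?_ ?_)
      · intro c₁ l₁ c₂ l₂ h1 h2
        rw [sw w hw]; exact hloc _ _ _ _
      · intro c₁ l₁ c₂ l₂ h1 h2
        rw [sw _ hσ]; exact hG0 _ _ _ _ h2 h1
      · intro c₁ l₁ c₂ l₂ h1 h2
        rw [sw w hw, sw _ hσ, mul_comm (volume (cube m c₁ l₁))]; exact H0 _ _ _ _ h2 h1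
  refine ⟨⟨fun h => main.trans_lt h, fun h => ?_⟩, main⟩
  rw [max_lt_iff] at h
  obtain ⟨hA, hB⟩ := h
  set KA := essSup (fun x₁ : Fin n → ℝ => apCube m p (fun x₂ => w (x₁, x₂))) volume with hKA
  set KB := essSup (fun x₂ : Fin m → ℝ => apCube n p (fun x₁ => w (x₁, x₂))) volume with hKB
  have hA' : ∀ᵐ x₁ : Fin n → ℝ, apCube m p (fun x₂ => w (x₁, x₂)) ≤ KA := ae_le_essSup
  have hB' : ∀ᵐ x₂ : Fin m → ℝ, apCube n p (fun x₁ => w (x₁, x₂)) ≤ KB := ae_le_essSup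
  refine lt_of_le_of_lt ?_ (ENNReal.mul_lt_top hA hB)
  have hpos' : ∀ᵐ y : Fin m → ℝ, ∀ᵐ x : Fin n → ℝ, 0 < w (x, y) ∧ w (x, y) < ⊤ := by
    have h1 : ∀ᵐ z ∂((volume : Measure (Fin n → ℝ)).prod (volume : Measure (Fin m → ℝ))),
        0 < w z ∧ w z < ⊤ := hpos
    exact Measure.ae_ae_of_ae_prod
      ((Measure.measurePreserving_swap (μ := (volume : Measure (Fin m → ℝ)))
        (ν := (volume : Measure (Fin n → ℝ)))).quasiMeasurePreserving.ae h1)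
  refine iSup_le fun c₁ => iSup_le fun l₁ => iSup_le fun h1 => iSup_le fun c₂ => iSup_le fun l₂ =>
    iSup_le fun h2 => ?_
  rw [hvol, norm_iff p hp _ _ _ _ (hv0 _ _ _ _ h1 h2) (hvt _ _ _ _),
    setLIntegral_prod_meas w hw, setLIntegral_prod_meas _ hσ]
  have f1 : IsFiniteMeasure (volume.restrict (cube n c₁ l₁)) :=
    ⟨by simpa using (vol_cube_ne_top n c₁ l₁).lt_top⟩
  have f2 : IsFiniteMeasure (volume.restrict (cube m c₂ l₂)) :=
    ⟨by simpa using (vol_cube_ne_top m c₂ l₂).lt_top⟩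
  refine (core_dir2 (volume.restrict (cube n c₁ l₁)) (volume.restrict (cube m c₂ l₂)) p hp w hw ?_
    (KA * volume (cube m c₂ l₂) ^ p) (KB * volume (cube n c₁ l₁) ^ p) ?_ ?_ ?_).trans (le_of_eq ?_)
  · filter_upwards [ae_restrict_of_ae hpos'] with y hy using ae_restrict_of_ae hy
  · filter_upwards [ae_restrict_of_ae hA'] with x hx
    rw [← norm_iff p hp _ _ _ _ (vol_cube_ne_zero _ _ _ h2) (vol_cube_ne_top _ _ _)]
    refine le_trans ?_ hx
    unfold apCube
    exact le_iSup_of_le c₂ <| le_iSup_of_le l₂ <| le_iSup_of_le h2 le_rfl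
  · filter_upwards [ae_restrict_of_ae hB'] with x hx
    rw [← norm_iff p hp _ _ _ _ (vol_cube_ne_zero _ _ _ h1) (vol_cube_ne_top _ _ _)]
    refine le_trans ?_ hx
    unfold apCube
    exact le_iSup_of_le c₁ <| le_iSup_of_le l₁ <| le_iSup_of_le h1 le_rfl
  · rw [← setLIntegral_prod_meas w hw]; exact (hloc _ _ _ _).ne
  · rw [ENNReal.mul_rpow_of_nonneg _ _ (by linarith)]; ring

end
end

section
/- Duality-type estimate for product BMO coefficients with good rectangles: let F ⊂ ℝ^{n+m}, ω a translation parameter, and 𝒞 a collection of dyadic rectangles with |R ∩ F| ≥ (99/100)|R| for all R ∈ 𝒞. Then for scalars {a_{R+ω}}_{R∈𝒞} and {b_R}_{R∈𝒞}: Σ_{R∈𝒞}|a_{R+ω} b_R| ≲ ‖{a_{R+ω}}‖_{BMO_prod(𝒟_ω)} · ∬_F (Σ_{R∈𝒞}|b_R|² 1_R/|R|)^{1/2}. -/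
open MeasureTheory Set Filter Topology ENNReal NNReal

noncomputable section

/-- The translation vector `Σ_{i : 2^{-i} < 2^{-k}} 2^{-i} ωᵢ` used to define the random
dyadic grid, applied to cubes of side length `2^{-k}`. -/
def shiftVec (d : ℕ) (ω : ℤ → Fin d → Bool) (k : ℤ) : Fin d → ℝ :=
  fun i0 => ∑' i : ℤ, if k < i ∧ ω i i0 = true then (2:ℝ)^(-i) else 0

/-- The translated dyadic cube `I + ω` of the randomly shifted grid `𝒟^d_ω`. -/
def tCube (d : ℕ) (ω : ℤ → Fin d → Bool) (k : ℤ) (n : Fin d → ℤ) : Set (Fin d → ℝ) :=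
  {x | ∀ i, (2:ℝ)^(-k) * (n i) + shiftVec d ω k i ≤ x i ∧
        x i < (2:ℝ)^(-k) * ((n i) + 1) + shiftVec d ω k i}

/-- The dyadic rectangle `I × J ∈ 𝒟₀ = 𝒟₀ⁿ × 𝒟₀ᵐ` indexed by
`p = ((k₁,n₁),(k₂,n₂))`. -/
def baseRect (n m : ℕ) (p : (ℤ × (Fin n → ℤ)) × (ℤ × (Fin m → ℤ))) :
    Set ((Fin n → ℝ) × (Fin m → ℝ)) :=
  dyadicCube n p.1.1 p.1.2 ×ˢ dyadicCube m p.2.1 p.2.2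

/-- The translated dyadic rectangle `R + ω ∈ 𝒟_ω`. -/
def tRect (n m : ℕ) (ω₁ : ℤ → Fin n → Bool) (ω₂ : ℤ → Fin m → Bool)
    (p : (ℤ × (Fin n → ℤ)) × (ℤ × (Fin m → ℤ))) : Set ((Fin n → ℝ) × (Fin m → ℝ)) :=
  tCube n ω₁ p.1.1 p.1.2 ×ˢ tCube m ω₂ p.2.1 p.2.2

/-- The product BMO norm of a sequence of scalars `a` attached to the rectangles
`rect i`: the supremum over admissible sets `Ω` (finite measure, and each point of `Ω`
lies in some grid rectangle contained in `Ω`) of `(|Ω|⁻¹ Σ_{rect i ⊆ Ω} |a i|²)^{1/2}`. -/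
def bmoProdSeq {ι ι' : Type*} {Xs : Type*} [MeasureSpace Xs]
    (gridRect : ι' → Set Xs) (rect : ι → Set Xs) (a : ι → ℝ) : ℝ≥0∞ :=
  ⨆ (Ω : Set Xs) (_ : volume Ω < ⊤)
    (_ : ∀ x ∈ Ω, ∃ j, x ∈ gridRect j ∧ gridRect j ⊆ Ω),
    ((volume Ω)⁻¹ * ∑' i : {i // rect i ⊆ Ω}, ((‖a i.1‖₊ : ℝ≥0∞)) ^ 2) ^ ((1:ℝ)/2)

namespace DualityAux

/-- doubled cube, containing both `I` and `I + ω` -/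
def bigCube (d : ℕ) (q : ℤ × (Fin d → ℤ)) : Set (Fin d → ℝ) :=
  {x | ∀ i, (2:ℝ)^(-q.1) * (q.2 i) ≤ x i ∧ x i < (2:ℝ)^(-q.1) * ((q.2 i) + 2)}

def cub (d : ℕ) (q : ℤ × (Fin d → ℤ)) : Set (Fin d → ℝ) := dyadicCube d q.1 q.2

lemma cub_eq (d : ℕ) (q : ℤ × (Fin d → ℤ)) :
    cub d q = Set.pi univ (fun i => Ico ((2:ℝ)^(-q.1) * (q.2 i)) ((2:ℝ)^(-q.1) * ((q.2 i) + 1))) := by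
  ext x; simp [cub, dyadicCube]

lemma bigCube_eq (d : ℕ) (q : ℤ × (Fin d → ℤ)) :
    bigCube d q = Set.pi univ (fun i => Ico ((2:ℝ)^(-q.1) * (q.2 i)) ((2:ℝ)^(-q.1) * ((q.2 i) + 2))) := by
  ext x; simp [bigCube]

lemma meas_cub (d : ℕ) (q : ℤ × (Fin d → ℤ)) : MeasurableSet (cub d q) := by
  rw [cub_eq]; exact MeasurableSet.univ_pi (fun i => measurableSet_Ico)

lemma meas_big (d : ℕ) (q : ℤ × (Fin d → ℤ)) : MeasurableSet (bigCube d q) := by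
  rw [bigCube_eq]; exact MeasurableSet.univ_pi (fun i => measurableSet_Ico)

lemma vol_cub (d : ℕ) (q : ℤ × (Fin d → ℤ)) :
    volume (cub d q) = ENNReal.ofReal ((2:ℝ)^(-q.1)) ^ d := by
  rw [cub_eq, Real.volume_pi_Ico]
  have : ∀ i, (2:ℝ)^(-q.1) * ((q.2 i) + 1) - (2:ℝ)^(-q.1) * (q.2 i) = (2:ℝ)^(-q.1) := by
    intro i; ring
  simp only [this]; simp

lemma vol_cub_ne_zero (d : ℕ) (q : ℤ × (Fin d → ℤ)) : volume (cub d q) ≠ 0 := by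
  rw [vol_cub]
  apply pow_ne_zero
  have : (0:ℝ) < (2:ℝ)^(-q.1) := by positivity
  simpa using this

lemma vol_cub_ne_top (d : ℕ) (q : ℤ × (Fin d → ℤ)) : volume (cub d q) ≠ ⊤ := by
  rw [vol_cub]
  exact ENNReal.pow_ne_top ENNReal.ofReal_ne_top

lemma vol_big_ne_top (d : ℕ) (q : ℤ × (Fin d → ℤ)) : volume (bigCube d q) ≠ ⊤ := by
  rw [bigCube_eq, Real.volume_pi_Ico]
  exact ENNReal.prod_ne_top (fun i _ => ENNReal.ofReal_ne_top)

lemma cub_nonempty (d : ℕ) (q : ℤ × (Fin d → ℤ)) : (cub d q).Nonempty :=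
  nonempty_of_measure_ne_zero (vol_cub_ne_zero d q)

lemma cub_sub_big (d : ℕ) (q : ℤ × (Fin d → ℤ)) : cub d q ⊆ bigCube d q := by
  intro x hx i
  have h := hx i
  have : (0:ℝ) < (2:ℝ)^(-q.1) := by positivity
  refine ⟨h.1, h.2.trans_le ?_⟩
  gcongr; norm_num

/-- geometric tail bound for the shift -/
lemma shift_bound (d : ℕ) (ω : ℤ → Fin d → Bool) (k : ℤ) (i0 : Fin d) :
    0 ≤ shiftVec d ω k i0 ∧ shiftVec d ω k i0 ≤ (2:ℝ)^(-k) := by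
  constructor
  · apply tsum_nonneg; intro i; split_ifs <;> positivity
  · unfold shiftVec
    let e : ℕ → ℤ := fun j => k + 1 + j
    have he : Function.Injective e := by intro a b h; simp only [e] at h; omega
    have hsupp : Function.support
        (fun i : ℤ => if k < i ∧ ω i i0 = true then (2:ℝ)^(-i) else 0) ⊆ Set.range e := by
      intro i hi
      simp only [Function.mem_support, ne_eq, ite_eq_right_iff, not_forall] at hi
      obtain ⟨h, -⟩ := hi
      exact ⟨(i - (k+1)).toNat, by simp only [e]; omega⟩
    rw [← he.tsum_eq hsupp]
    have hg : HasSum (fun j : ℕ => (2:ℝ)^(-k) / 2 / 2 ^ j) ((2:ℝ)^(-k)) :=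
      hasSum_geometric_two' _
    have hle : ∀ j : ℕ, (if k < e j ∧ ω (e j) i0 = true then (2:ℝ)^(-(e j)) else 0)
        ≤ (2:ℝ)^(-k) / 2 / 2 ^ j := by
      intro j
      have h2 : (2:ℝ)^(-(e j)) = (2:ℝ)^(-k) / 2 / 2 ^ j := by
        simp only [e, neg_add]
        rw [zpow_add₀ (by norm_num), zpow_add₀ (by norm_num), zpow_neg (2:ℝ) (j:ℤ), zpow_natCast,
          zpow_neg_one]
        rfl
      split_ifs
      · exact h2.le
      · positivity
    have hs : Summable (fun j : ℕ => (if k < e j ∧ ω (e j) i0 = true then (2:ℝ)^(-(e j)) else 0)) :=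
      Summable.of_nonneg_of_le (fun j => by split_ifs <;> positivity) hle hg.summable
    exact (hs.tsum_le_tsum hle hg.summable).trans hg.tsum_eq.le

lemma tCube_sub_big (d : ℕ) (ω : ℤ → Fin d → Bool) (q : ℤ × (Fin d → ℤ)) :
    tCube d ω q.1 q.2 ⊆ bigCube d q := by
  intro x hx i
  have h := hx i
  have hs := shift_bound d ω q.1 i
  constructor <;> nlinarith

lemma one_param_N (d : ℕ) (E : Set (Fin d → ℝ)) (A : Set (ℤ × (Fin d → ℤ))) (N : ℕ)
    (hN : ∀ q ∈ A, -(N:ℤ) ≤ q.1)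
    (hA : ∀ q ∈ A, volume (cub d q) ≤ 4 * volume (cub d q ∩ E)) :
    volume (⋃ q ∈ A, bigCube d q) ≤ (4 * 10 ^ d) * volume E := by
  obtain ⟨u, huA, hdis, hcov⟩ := Vitali.exists_disjoint_subfamily_covering_enlargement
    (fun q => cub d q) A (fun q => (2:ℝ)^(-q.1)) 2 (by norm_num) (fun a _ => by positivity)
    ((2:ℝ)^(N:ℤ)) (fun a ha => zpow_le_zpow_right₀ (by norm_num) (by have := hN a ha; omega))
    (fun a _ => cub_nonempty d a)
  have hsub : (⋃ q ∈ A, bigCube d q) ⊆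
      ⋃ q ∈ u, Metric.closedBall (fun i => (2:ℝ)^(-q.1) * (q.2 i)) (5 * (2:ℝ)^(-q.1)) := by
    intro x hx
    simp only [mem_iUnion, exists_prop] at hx ⊢
    obtain ⟨q, hq, hxq⟩ := hx
    obtain ⟨r, hr, ⟨z, hzq, hzr⟩, hle⟩ := hcov q hq
    refine ⟨r, hr, ?_⟩
    rw [Metric.mem_closedBall, dist_pi_le_iff (by positivity)]
    intro i
    have h1 := hxq i
    have h2 := hzq i
    have h3 := hzr i
    change (2:ℝ)^(-q.1) ≤ 2 * (2:ℝ)^(-r.1) at hle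
    rw [Real.dist_eq, abs_le]
    constructor <;> nlinarith
  have hcount : u.Countable := Set.to_countable u
  calc volume (⋃ q ∈ A, bigCube d q)
      ≤ volume (⋃ q ∈ u, Metric.closedBall (fun i => (2:ℝ)^(-q.1) * (q.2 i : ℝ)) (5 * (2:ℝ)^(-q.1))) :=
        measure_mono hsub
    _ ≤ ∑' q : u, volume (Metric.closedBall (fun i => (2:ℝ)^(-q.1.1) * (q.1.2 i : ℝ)) (5 * (2:ℝ)^(-q.1.1))) :=
        measure_biUnion_le _ hcount _
    _ ≤ ∑' q : u, (4 * 10 ^ d) * (volume.restrict E) (cub d q.1) := by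
        apply ENNReal.tsum_le_tsum
        intro q
        rw [Real.volume_pi_closedBall _ (by positivity), Measure.restrict_apply (meas_cub d q.1)]
        have h := hA q.1 (huA q.2)
        calc _ = 10 ^ d * volume (cub d q.1) := by
              rw [vol_cub, Fintype.card_fin, ← mul_assoc, mul_pow,
                ENNReal.ofReal_mul (by positivity), ENNReal.ofReal_pow (by norm_num),
                ENNReal.ofReal_pow (by positivity)]
              norm_num
          _ ≤ 10 ^ d * (4 * volume (cub d q.1 ∩ E)) := by gcongr
          _ = _ := by ring
    _ = (4 * 10 ^ d) * (volume.restrict E) (⋃ q ∈ u, cub d q) := by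
        rw [ENNReal.tsum_mul_left, measure_biUnion hcount hdis (fun q _ => meas_cub d q)]
    _ ≤ (4 * 10 ^ d) * volume E := by
        refine mul_le_mul' le_rfl ?_
        exact (measure_mono (subset_univ _)).trans (Measure.restrict_apply_univ E).le

lemma one_param (d : ℕ) (E : Set (Fin d → ℝ)) (A : Set (ℤ × (Fin d → ℤ)))
    (hA : ∀ q ∈ A, volume (cub d q) ≤ 4 * volume (cub d q ∩ E)) :
    volume (⋃ q ∈ A, bigCube d q) ≤ (4 * 10 ^ d) * volume E := by
  have h : (⋃ q ∈ A, bigCube d q) = ⋃ N : ℕ, ⋃ q ∈ A ∩ {q | -(N:ℤ) ≤ q.1}, bigCube d q := by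
    ext x
    simp only [mem_iUnion, exists_prop, mem_inter_iff, mem_ofPred_eq]
    constructor
    · rintro ⟨q, hq, hx⟩
      exact ⟨(-q.1).toNat, q, ⟨hq, by omega⟩, hx⟩
    · rintro ⟨N, q, hq, hx⟩
      exact ⟨q, hq.1, hx⟩
  have hmono : Monotone (fun N : ℕ => ⋃ q ∈ A ∩ {q | -(N:ℤ) ≤ q.1}, bigCube d q) := by
    intro N M hNM
    apply biUnion_subset_biUnion_left
    rintro q ⟨h1, h2⟩
    refine ⟨h1, ?_⟩
    simp only [mem_ofPred_eq] at h2 ⊢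
    omega
  rw [h, hmono.measure_iUnion]
  exact iSup_le (fun N => one_param_N d E _ N (fun q hq => hq.2) (fun q hq => hA q hq.1))

lemma two_param (n m : ℕ) (E : Set ((Fin n → ℝ) × (Fin m → ℝ))) (hE : MeasurableSet E)
    (B : Set ((ℤ × (Fin n → ℤ)) × (ℤ × (Fin m → ℤ))))
    (hB : ∀ p ∈ B, volume (baseRect n m p) ≤ 2 * volume (baseRect n m p ∩ E)) :
    volume (⋃ p ∈ B, bigCube n p.1 ×ˢ bigCube m p.2) ≤
      (4 * 10 ^ m) * ((4 * 10 ^ n) * volume E) := by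
  set G : (ℤ × (Fin n → ℤ)) → Set (Fin m → ℝ) := fun q =>
    {y | volume (cub n q) ≤ 4 * volume (cub n q ∩ (fun x => (x, y)) ⁻¹' E)} with hG
  have hgm : ∀ q, Measurable (fun y => volume (cub n q ∩ (fun x => (x, y)) ⁻¹' E)) := by
    intro q
    have : MeasurableSet ((Prod.fst ⁻¹' cub n q) ∩ E) := (measurable_fst (meas_cub n q)).inter hE
    exact measurable_measure_prodMk_right this
  have hGm : ∀ q, MeasurableSet (G q) := fun q =>
    measurableSet_le measurable_const ((hgm q).const_mul 4)
  set E1 : Set ((Fin n → ℝ) × (Fin m → ℝ)) := ⋃ q, bigCube n q ×ˢ G q with hE1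
  have hE1m : MeasurableSet E1 := MeasurableSet.iUnion (fun q => (meas_big n q).prod (hGm q))
  have hE1v : volume E1 ≤ (4 * 10 ^ n) * volume E := by
    rw [Measure.volume_eq_prod, Measure.prod_apply_symm hE1m, Measure.prod_apply_symm hE,
      ← lintegral_const_mul _ (measurable_measure_prodMk_right hE)]
    apply lintegral_mono
    intro y
    refine le_trans (measure_mono ?_) (one_param n ((fun x => (x, y)) ⁻¹' E) {q | y ∈ G q} (fun q hq => hq))
    intro x hx
    simp only [hE1, mem_preimage, mem_iUnion, mem_prod] at hx
    obtain ⟨q, hx1, hx2⟩ := hx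
    simp only [mem_iUnion]
    exact ⟨q, hx2, hx1⟩
  have key : ∀ p ∈ B, volume (cub m p.2) ≤ 4 * volume (cub m p.2 ∩ G p.1) := by
    intro p hp
    have h0 := hB p hp
    set I := cub n p.1
    set J := cub m p.2
    have hR : baseRect n m p = I ×ˢ J := rfl
    have hJ : MeasurableSet J := meas_cub m p.2
    have hI : MeasurableSet I := meas_cub n p.1
    have hI0 : volume I ≠ 0 := vol_cub_ne_zero n p.1
    have hIt : volume I ≠ ⊤ := vol_cub_ne_top n p.1
    have hJt : volume J ≠ ⊤ := vol_cub_ne_top m p.2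
    rw [hR, Measure.volume_eq_prod, Measure.prod_prod,
      Measure.prod_apply_symm ((hI.prod hJ).inter hE)] at h0
    have h1 : ∫⁻ y, volume ((fun x => (x, y)) ⁻¹' (I ×ˢ J ∩ E)) ≤
        ∫⁻ y, ((J ∩ G p.1).indicator (fun _ => volume I) y + J.indicator (fun _ => volume I / 4) y) := by
      apply lintegral_mono
      intro y
      beta_reduce
      by_cases hy : y ∈ J
      · by_cases hyG : y ∈ G p.1
        · rw [indicator_of_mem (show y ∈ J ∩ G p.1 from ⟨hy, hyG⟩)]
          refine le_trans (measure_mono ?_) le_self_add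
          intro x hx; exact hx.1.1
        · rw [indicator_of_mem hy]
          refine le_trans ?_ le_add_self
          rw [ENNReal.le_div_iff_mul_le (by simp) (by simp), mul_comm]
          have : 4 * volume (I ∩ (fun x => (x, y)) ⁻¹' E) ≤ volume I := (not_le.1 hyG).le
          refine le_trans ?_ this
          gcongr
          intro x hx; exact ⟨hx.1.1, hx.2⟩
      · have : ((fun x => (x, y)) ⁻¹' (I ×ˢ J ∩ E)) = ∅ := by
          ext x; simp [hy]
        rw [this]; simp
    rw [lintegral_add_left (measurable_const.indicator (hJ.inter (hGm _))),
      lintegral_indicator_const (hJ.inter (hGm _)), lintegral_indicator_const hJ] at h1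
    have h2 : volume I * volume J ≤ 2 * (volume I * volume (J ∩ G p.1) + volume I / 4 * volume J) :=
      h0.trans (by gcongr)
    have hJGt : volume (J ∩ G p.1) ≠ ⊤ := ne_top_of_le_ne_top hJt (measure_mono inter_subset_left)
    revert h2 hI0 hIt hJt hJGt
    generalize volume I = v
    generalize volume J = w
    generalize volume (J ∩ G p.1) = g
    intro hv hvt hwt h2 hgt
    lift v to ℝ≥0 using hvt
    lift w to ℝ≥0 using hwt
    lift g to ℝ≥0 using hgt
    have h4 : ((v:ℝ≥0∞) / 4) = ((v / 4 : ℝ≥0) : ℝ≥0∞) := by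
      rw [ENNReal.coe_div (by norm_num)]; rfl
    rw [h4] at h2
    have hv' : v ≠ 0 := by simpa using hv
    have hvp : (0:ℝ) < v := by positivity
    have h3 : v * w ≤ 2 * (v * g + v / 4 * w) := by exact_mod_cast h2
    have h5 : (v:ℝ) * w ≤ 2 * (v * g + v / 4 * w) := by exact_mod_cast h3
    have h6 : (w:ℝ) ≤ 4 * g := by
      by_contra hc
      push Not at hc
      nlinarith
    have h7 : w ≤ 4 * g := by exact_mod_cast h6
    exact_mod_cast h7
  have hUm : MeasurableSet (⋃ p ∈ B, bigCube n p.1 ×ˢ bigCube m p.2) :=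
    MeasurableSet.biUnion (Set.to_countable B) (fun p _ => (meas_big n p.1).prod (meas_big m p.2))
  calc volume (⋃ p ∈ B, bigCube n p.1 ×ˢ bigCube m p.2)
      ≤ (4 * 10 ^ m) * volume E1 := by
        rw [Measure.volume_eq_prod, Measure.prod_apply hUm, Measure.prod_apply hE1m,
          ← lintegral_const_mul _ (measurable_measure_prodMk_left hE1m)]
        apply lintegral_mono
        intro x
        refine le_trans (measure_mono ?_) (one_param m (Prod.mk x ⁻¹' E1)
          {r | ∃ p ∈ B, p.2 = r ∧ x ∈ bigCube n p.1} ?_)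
        · intro y hy
          simp only [mem_preimage, mem_iUnion, mem_prod, exists_prop] at hy
          obtain ⟨p, hp, hx, hy⟩ := hy
          simp only [mem_iUnion]
          exact ⟨p.2, ⟨p, hp, rfl, hx⟩, hy⟩
        · rintro r ⟨p, hp, rfl, hx⟩
          refine (key p hp).trans ?_
          gcongr
          intro y hy
          simp only [hE1, mem_preimage, mem_iUnion]
          exact ⟨p.1, hx, hy⟩
    _ ≤ _ := by gcongr

end DualityAux

namespace DualityAux

/-- dyadic thresholds -/
def thr (k : ℤ) : ℝ≥0∞ := ENNReal.ofReal ((2:ℝ)^k)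

lemma thr_succ (k : ℤ) : thr (k+1) = 2 * thr k := by
  unfold thr
  rw [zpow_add_one₀ (by norm_num), mul_comm, ENNReal.ofReal_mul (by norm_num)]
  norm_num

lemma thr_mono {k l : ℤ} (h : k ≤ l) : thr k ≤ thr l :=
  ENNReal.ofReal_le_ofReal (zpow_le_zpow_right₀ (by norm_num) h)

lemma thr_ne_top (k : ℤ) : thr k ≠ ⊤ := ENNReal.ofReal_ne_top

lemma exists_thr_lt {s : ℝ≥0∞} (hs : s ≠ 0) : ∃ k, thr k < s := by
  obtain ⟨r, hr0, hr⟩ := ENNReal.lt_iff_exists_nnreal_btwn.1 (pos_iff_ne_zero.2 hs)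
  have hr0' : (0:ℝ) < r := by exact_mod_cast hr0
  obtain ⟨n, hn⟩ := exists_pow_lt_of_lt_one hr0' (show (1/2:ℝ) < 1 by norm_num)
  refine ⟨-(n:ℤ), lt_of_le_of_lt ?_ hr⟩
  unfold thr
  rw [← ENNReal.ofReal_coe_nnreal]
  apply ENNReal.ofReal_le_ofReal
  rw [zpow_neg, zpow_natCast]
  simpa using hn.le

lemma exists_lt_thr {s : ℝ≥0∞} (hs : s ≠ ⊤) : ∃ k, s < thr k := by
  lift s to ℝ≥0 using hs
  obtain ⟨n, hn⟩ := pow_unbounded_of_one_lt (s:ℝ) (show (1:ℝ) < 2 by norm_num)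
  refine ⟨(n:ℤ), ?_⟩
  unfold thr
  rw [← ENNReal.ofReal_coe_nnreal, zpow_natCast]
  exact (ENNReal.ofReal_lt_ofReal_iff (by positivity)).2 hn

lemma thr_sum (s : ℝ≥0∞) : ∑' k : ℤ, {x | thr k < x}.indicator (fun _ => thr k) s ≤ 2 * s := by
  by_cases hs : s = ⊤
  · simp [hs]
  lift s to ℝ≥0 using hs
  have h1 : ∀ k : ℤ, {x | thr k < x}.indicator (fun _ => thr k) (s:ℝ≥0∞) ≤
      2 * volume (Ioc ((2:ℝ)^(k-1)) ((2:ℝ)^k) ∩ Ioc 0 (s:ℝ)) := by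
    intro k
    by_cases hk : thr k < s
    · rw [indicator_of_mem (by exact hk)]
      have hk' : (2:ℝ)^k < s := by
        unfold thr at hk
        rw [← ENNReal.ofReal_coe_nnreal] at hk
        exact (ENNReal.ofReal_lt_ofReal_iff_of_nonneg (by positivity)).1 hk
      have h2 : Ioc ((2:ℝ)^(k-1)) ((2:ℝ)^k) ∩ Ioc 0 (s:ℝ) = Ioc ((2:ℝ)^(k-1)) ((2:ℝ)^k) := by
        apply inter_eq_left.2
        intro x hx
        exact ⟨lt_trans (by positivity) hx.1, hx.2.trans hk'.le⟩
      rw [h2, Real.volume_Ioc]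
      have h3 : (2:ℝ)^k - (2:ℝ)^(k-1) = (2:ℝ)^(k-1) := by
        rw [zpow_sub_one₀ (by norm_num)]; ring
      rw [h3]
      have := thr_succ (k-1)
      rw [sub_add_cancel] at this
      exact this.le
    · rw [indicator_of_notMem (by exact hk)]; exact zero_le
  calc _ ≤ ∑' k : ℤ, 2 * volume (Ioc ((2:ℝ)^(k-1)) ((2:ℝ)^k) ∩ Ioc 0 (s:ℝ)) :=
        ENNReal.tsum_le_tsum h1
    _ = 2 * volume (⋃ k : ℤ, Ioc ((2:ℝ)^(k-1)) ((2:ℝ)^k) ∩ Ioc 0 (s:ℝ)) := by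
        rw [ENNReal.tsum_mul_left, measure_iUnion]
        · intro i j hij
          refine Disjoint.mono inter_subset_left inter_subset_left ?_
          rw [Set.disjoint_left]
          intro x hx hy
          have a1 := hx.1.trans_le hy.2
          have a2 := hy.1.trans_le hx.2
          rw [zpow_lt_zpow_iff_right₀ (by norm_num)] at a1 a2
          omega
        · intro i; exact measurableSet_Ioc.inter measurableSet_Ioc
    _ ≤ 2 * volume (Ioc 0 (s:ℝ)) := by
        gcongr
        exact iUnion_subset (fun k => inter_subset_right)
    _ = 2 * s := by rw [Real.volume_Ioc]; simp

lemma tsum_cs {ι : Type*} (f g : ι → ℝ≥0∞) :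
    ∑' i, f i * g i ≤ (∑' i, f i ^ 2) ^ ((1:ℝ)/2) * (∑' i, g i ^ 2) ^ ((1:ℝ)/2) := by
  rw [ENNReal.tsum_eq_iSup_sum]
  apply iSup_le
  intro s
  refine (ENNReal.inner_le_Lp_mul_Lq s f g Real.HolderConjugate.two_two).trans ?_
  simp only [ENNReal.rpow_two]
  gcongr <;> exact ENNReal.sum_le_tsum s

lemma sq_half (x : ℝ≥0∞) : (x ^ ((1:ℝ)/2)) ^ 2 = x := by
  rw [← ENNReal.rpow_two, ← ENNReal.rpow_mul]; norm_num

lemma half_sq (x : ℝ≥0∞) : (x ^ 2) ^ ((1:ℝ)/2) = x := by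
  rw [← ENNReal.rpow_two, ← ENNReal.rpow_mul]; norm_num

lemma bmo_le {ι ι' : Type*} {Xs : Type*} [MeasureSpace Xs]
    (gridRect : ι' → Set Xs) (rect : ι → Set Xs) (a : ι → ℝ) (Ω : Set Xs) (h1 : volume Ω < ⊤)
    (h2 : ∀ x ∈ Ω, ∃ j, x ∈ gridRect j ∧ gridRect j ⊆ Ω) (h3 : bmoProdSeq gridRect rect a ≠ ⊤) :
    ∑' i : {i // rect i ⊆ Ω}, ((‖a i.1‖₊ : ℝ≥0∞)) ^ 2 ≤
      bmoProdSeq gridRect rect a ^ 2 * volume Ω := by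
  have h : ((volume Ω)⁻¹ * ∑' i : {i // rect i ⊆ Ω}, ((‖a i.1‖₊ : ℝ≥0∞)) ^ 2) ^ ((1:ℝ)/2) ≤
      bmoProdSeq gridRect rect a := by
    unfold bmoProdSeq
    exact le_iSup_of_le Ω (le_iSup_of_le h1 (le_iSup_of_le h2 le_rfl))
  have h' := pow_le_pow_left' h 2
  rw [sq_half, mul_comm, ← div_eq_mul_inv] at h'
  rwa [ENNReal.div_le_iff_le_mul (Or.inr (ENNReal.pow_ne_top h3)) (Or.inl h1.ne)] at h'

lemma meas_base (n m : ℕ) (p) : MeasurableSet (baseRect n m p) :=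
  (meas_cub n p.1).prod (meas_cub m p.2)

lemma vol_base_ne_zero (n m : ℕ) (p) : volume (baseRect n m p) ≠ 0 := by
  have : baseRect n m p = cub n p.1 ×ˢ cub m p.2 := rfl
  rw [this, Measure.volume_eq_prod, Measure.prod_prod]
  exact mul_ne_zero (vol_cub_ne_zero _ _) (vol_cub_ne_zero _ _)

lemma vol_base_ne_top (n m : ℕ) (p) : volume (baseRect n m p) ≠ ⊤ := by
  have : baseRect n m p = cub n p.1 ×ˢ cub m p.2 := rfl
  rw [this, Measure.volume_eq_prod, Measure.prod_prod]
  exact ENNReal.mul_ne_top (vol_cub_ne_top _ _) (vol_cub_ne_top _ _)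

lemma base_sub (n m : ℕ) (p) : baseRect n m p ⊆ bigCube n p.1 ×ˢ bigCube m p.2 :=
  prod_mono (cub_sub_big n p.1) (cub_sub_big m p.2)

lemma tRect_sub (n m : ℕ) (ω₁ ω₂) (p) : tRect n m ω₁ ω₂ p ⊆ bigCube n p.1 ×ˢ bigCube m p.2 :=
  prod_mono (tCube_sub_big n ω₁ p.1) (tCube_sub_big m ω₂ p.2)

lemma vol_tRect_lt_top (n m : ℕ) (ω₁ ω₂) (p) : volume (tRect n m ω₁ ω₂ p) < ⊤ := by
  refine (measure_mono (tRect_sub n m ω₁ ω₂ p)).trans_lt ?_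
  rw [Measure.volume_eq_prod, Measure.prod_prod]
  exact ENNReal.mul_lt_top (vol_big_ne_top _ _).lt_top (vol_big_ne_top _ _).lt_top

/-- squared square function -/
def sq2 (n m : ℕ) (𝒞 : Set ((ℤ × (Fin n → ℤ)) × (ℤ × (Fin m → ℤ))))
    (b : (ℤ × (Fin n → ℤ)) × (ℤ × (Fin m → ℤ)) → ℝ) (x : (Fin n → ℝ) × (Fin m → ℝ)) : ℝ≥0∞ :=
  ∑' p : 𝒞, (‖b p.1‖₊ : ℝ≥0∞) ^ 2 *
    (baseRect n m p.1).indicator (fun _ => (volume (baseRect n m p.1))⁻¹) x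

section main
variable {n m : ℕ} {𝒞 : Set ((ℤ × (Fin n → ℤ)) × (ℤ × (Fin m → ℤ)))}
  {b : (ℤ × (Fin n → ℤ)) × (ℤ × (Fin m → ℤ)) → ℝ}

lemma sq2_term_meas (p : 𝒞) : Measurable (fun x => (‖b p.1‖₊ : ℝ≥0∞) ^ 2 *
    (baseRect n m p.1).indicator (fun _ => (volume (baseRect n m p.1))⁻¹) x) :=
  (measurable_const.indicator (meas_base n m p.1)).const_mul _

lemma sq2_meas : Measurable (sq2 n m 𝒞 b) :=
  Measurable.tsum (fun p => sq2_term_meas p)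

lemma sq_meas : Measurable (fun x => (sq2 n m 𝒞 b x) ^ ((1:ℝ)/2)) :=
  sq2_meas.pow_const _

lemma sq2_lower (p : 𝒞) (hb : b p.1 ≠ 0) :
    ∃ s : ℝ≥0∞, s ≠ 0 ∧ ∀ x ∈ baseRect n m p.1, s ≤ (sq2 n m 𝒞 b x) ^ ((1:ℝ)/2) := by
  refine ⟨((‖b p.1‖₊ : ℝ≥0∞) ^ 2 * (volume (baseRect n m p.1))⁻¹) ^ ((1:ℝ)/2), ?_, ?_⟩
  · have h1 : (‖b p.1‖₊ : ℝ≥0∞) ^ 2 * (volume (baseRect n m p.1))⁻¹ ≠ 0 := by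
      apply mul_ne_zero
      · apply pow_ne_zero; simpa using hb
      · exact ENNReal.inv_ne_zero.2 (vol_base_ne_top n m p.1)
    intro h
    rw [ENNReal.rpow_eq_zero_iff_of_pos (by norm_num)] at h
    exact h1 h
  · intro x hx
    apply ENNReal.rpow_le_rpow _ (by norm_num)
    have := ENNReal.le_tsum (f := fun p : 𝒞 => (‖b p.1‖₊ : ℝ≥0∞) ^ 2 *
      (baseRect n m p.1).indicator (fun _ => (volume (baseRect n m p.1))⁻¹) x) p
    rw [indicator_of_mem hx] at this
    exact this

/-- level sets -/
def lev (𝒞 : Set ((ℤ × (Fin n → ℤ)) × (ℤ × (Fin m → ℤ))))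
    (b : (ℤ × (Fin n → ℤ)) × (ℤ × (Fin m → ℤ)) → ℝ)
    (F : Set ((Fin n → ℝ) × (Fin m → ℝ))) (k : ℤ) : Set ((Fin n → ℝ) × (Fin m → ℝ)) :=
  F ∩ {x | thr k < (sq2 n m 𝒞 b x) ^ ((1:ℝ)/2)}

/-- the rectangles selected at level `k` -/
def sel (𝒞 : Set ((ℤ × (Fin n → ℤ)) × (ℤ × (Fin m → ℤ))))
    (b : (ℤ × (Fin n → ℤ)) × (ℤ × (Fin m → ℤ)) → ℝ)
    (F : Set ((Fin n → ℝ) × (Fin m → ℝ))) (k : ℤ) : Set ((ℤ × (Fin n → ℤ)) × (ℤ × (Fin m → ℤ))) :=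
  {p | p ∈ 𝒞 ∧ volume (baseRect n m p) ≤ 2 * volume (baseRect n m p ∩ lev 𝒞 b F k) ∧
    ¬ volume (baseRect n m p) ≤ 2 * volume (baseRect n m p ∩ lev 𝒞 b F (k+1))}

variable {F : Set ((Fin n → ℝ) × (Fin m → ℝ))}

lemma lev_meas (hF : MeasurableSet F) (k : ℤ) : MeasurableSet (lev 𝒞 b F k) :=
  hF.inter (measurableSet_lt measurable_const sq_meas)

lemma lev_anti {k l : ℤ} (h : k ≤ l) : lev 𝒞 b F l ⊆ lev 𝒞 b F k :=
  fun _ hx => ⟨hx.1, (thr_mono h).trans_lt hx.2⟩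

lemma lev_markov (hF : MeasurableSet F) (k : ℤ) :
    thr k * volume (lev 𝒞 b F k) ≤ ∫⁻ x in F, (sq2 n m 𝒞 b x) ^ ((1:ℝ)/2) := by
  refine le_trans ?_ (mul_meas_ge_le_lintegral sq_meas (thr k))
  rw [Measure.restrict_apply (measurableSet_le measurable_const sq_meas)]
  gcongr
  intro x hx
  have h2 : thr k < (sq2 n m 𝒞 b x) ^ ((1:ℝ)/2) := hx.2
  exact ⟨h2.le, hx.1⟩

lemma thr_ne_zero (k : ℤ) : thr k ≠ 0 := by
  unfold thr
  have : (0:ℝ) < (2:ℝ)^k := by positivity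
  simpa using this

lemma exists_sel (hF : MeasurableSet F)
    (hC : ∀ p ∈ 𝒞, (99/100 : ℝ≥0∞) * volume (baseRect n m p) ≤ volume (baseRect n m p ∩ F))
    (hQ : ∫⁻ x in F, (sq2 n m 𝒞 b x) ^ ((1:ℝ)/2) ≠ ⊤) (p : 𝒞) (hb : b p.1 ≠ 0) :
    ∃ k, p.1 ∈ sel 𝒞 b F k := by
  set Q := ∫⁻ x in F, (sq2 n m 𝒞 b x) ^ ((1:ℝ)/2)
  set R := baseRect n m p.1
  have hR0 : volume R ≠ 0 := vol_base_ne_zero n m p.1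
  have hRt : volume R ≠ ⊤ := vol_base_ne_top n m p.1
  have hex : ∃ k, volume R ≤ 2 * volume (R ∩ lev 𝒞 b F k) := by
    obtain ⟨s, hs0, hs⟩ := sq2_lower p hb
    obtain ⟨k, hk⟩ := exists_thr_lt hs0
    refine ⟨k, ?_⟩
    have h1 : R ∩ F ⊆ R ∩ lev 𝒞 b F k := fun x hx => ⟨hx.1, hx.2, hk.trans_le (hs x hx.1)⟩
    calc volume R = 1 * volume R := (one_mul _).symm
      _ ≤ (2 * (99/100)) * volume R := by
          gcongr
          rw [← mul_div_assoc, ENNReal.le_div_iff_mul_le (by simp) (by simp)]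
          norm_num
      _ = 2 * ((99/100) * volume R) := by ring
      _ ≤ 2 * volume (R ∩ F) := by gcongr; exact hC p.1 p.2
      _ ≤ _ := by gcongr
  have hbd : ∃ K : ℤ, ∀ k, volume R ≤ 2 * volume (R ∩ lev 𝒞 b F k) → k ≤ K := by
    obtain ⟨K, hK⟩ := exists_lt_thr (s := 2 * Q / volume R)
      (ENNReal.div_ne_top (ENNReal.mul_ne_top (by simp) hQ) hR0)
    refine ⟨K, fun k hk => ?_⟩
    by_contra hc
    push Not at hc
    have h1 : thr k * volume R ≤ 2 * Q := by
      calc thr k * volume R ≤ thr k * (2 * volume (lev 𝒞 b F k)) := by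
            gcongr; exact hk.trans (by gcongr; exact inter_subset_right)
        _ = 2 * (thr k * volume (lev 𝒞 b F k)) := by ring
        _ ≤ _ := by gcongr; exact lev_markov hF k
    have h2 : thr k ≤ 2 * Q / volume R :=
      (ENNReal.le_div_iff_mul_le (Or.inl hR0) (Or.inl hRt)).2 h1
    exact absurd (h2.trans_lt hK) (not_lt.2 (thr_mono hc.le))
  obtain ⟨k, hk, hmax⟩ := Int.exists_greatest_of_bdd hbd hex
  refine ⟨k, p.2, hk, fun h => ?_⟩
  have := hmax (k+1) h
  omega

lemma sel_b (hF : MeasurableSet F)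
    (hC : ∀ p ∈ 𝒞, (99/100 : ℝ≥0∞) * volume (baseRect n m p) ≤ volume (baseRect n m p ∩ F))
    (k : ℤ) (U : Set ((Fin n → ℝ) × (Fin m → ℝ))) (hUm : MeasurableSet U)
    (hU : ∀ p ∈ sel 𝒞 b F k, baseRect n m p ⊆ U) :
    ∑' p : 𝒞, (sel 𝒞 b F k).indicator (fun p => (‖b p‖₊ : ℝ≥0∞)^2) p.1 ≤
      4 * (thr (k+1) ^ 2 * volume U) := by
  set H : Set ((Fin n → ℝ) × (Fin m → ℝ)) :=
    (F ∩ U) ∩ {x | (sq2 n m 𝒞 b x) ^ ((1:ℝ)/2) ≤ thr (k+1)} with hH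
  have hHm : MeasurableSet H := (hF.inter hUm).inter (measurableSet_le sq_meas measurable_const)
  have h1 : ∀ p : 𝒞, (sel 𝒞 b F k).indicator (fun p => (‖b p‖₊ : ℝ≥0∞)^2) p.1 ≤
      4 * ∫⁻ x in H, (‖b p.1‖₊ : ℝ≥0∞) ^ 2 *
        (baseRect n m p.1).indicator (fun _ => (volume (baseRect n m p.1))⁻¹) x := by
    intro p
    by_cases hp : p.1 ∈ sel 𝒞 b F k
    · rw [indicator_of_mem hp, lintegral_const_mul _ (measurable_const.indicator (meas_base n m p.1)),
        lintegral_indicator_const (meas_base n m p.1), Measure.restrict_apply (meas_base n m p.1)]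
      set R := baseRect n m p.1
      have hR0 : volume R ≠ 0 := vol_base_ne_zero n m p.1
      have hRt : volume R ≠ ⊤ := vol_base_ne_top n m p.1
      have key : volume R ≤ 4 * volume (R ∩ H) := by
        have e1 : volume (R ∩ F) ≤ volume (R ∩ lev 𝒞 b F (k+1)) + volume (R ∩ H) := by
          refine (measure_mono ?_).trans (measure_union_le _ _)
          intro x hx
          by_cases hc : thr (k+1) < (sq2 n m 𝒞 b x) ^ ((1:ℝ)/2)
          · exact Or.inl ⟨hx.1, hx.2, hc⟩
          · exact Or.inr ⟨hx.1, ⟨hx.2, hU p.1 hp hx.1⟩, not_lt.1 hc⟩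
        have e2 := (hC p.1 p.2).trans e1
        have e3 : 2 * volume (R ∩ lev 𝒞 b F (k+1)) ≤ volume R := (not_le.1 hp.2.2).le
        have t1 : volume (R ∩ lev 𝒞 b F (k+1)) ≠ ⊤ := ne_top_of_le_ne_top hRt (measure_mono inter_subset_left)
        have t2 : volume (R ∩ H) ≠ ⊤ := ne_top_of_le_ne_top hRt (measure_mono inter_subset_left)
        change 99/100 * volume R ≤ _ at e2
        clear e1
        generalize volume (R ∩ lev 𝒞 b F (k+1)) = u at *
        generalize volume (R ∩ H) = w at *
        generalize volume R = v at *
        lift u to ℝ≥0 using t1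
        lift w to ℝ≥0 using t2
        lift v to ℝ≥0 using hRt
        have h4 : (99/100:ℝ≥0∞) = ((99/100 : ℝ≥0) : ℝ≥0∞) := by
          rw [ENNReal.coe_div (by norm_num)]; rfl
        rw [h4] at e2
        have e2' : (99/100) * v ≤ u + w := by exact_mod_cast e2
        have e3' : 2 * u ≤ v := by exact_mod_cast e3
        have e2'' : (99/100) * (v:ℝ) ≤ u + w := by exact_mod_cast e2'
        have e3'' : 2 * (u:ℝ) ≤ v := by exact_mod_cast e3'
        have e4 : (v:ℝ) ≤ 4 * w := by
          have := v.2
          have hv : (0:ℝ) ≤ v := v.2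
          linarith
        have e5 : v ≤ 4 * w := by exact_mod_cast e4
        exact_mod_cast e5
      calc (‖b p.1‖₊ : ℝ≥0∞)^2 = (‖b p.1‖₊ : ℝ≥0∞)^2 * ((volume R)⁻¹ * volume R) := by
            rw [ENNReal.inv_mul_cancel hR0 hRt, mul_one]
        _ ≤ (‖b p.1‖₊ : ℝ≥0∞)^2 * ((volume R)⁻¹ * (4 * volume (R ∩ H))) := by gcongr
        _ = _ := by ring
    · rw [indicator_of_notMem hp]; exact zero_le
  calc _ ≤ ∑' p : 𝒞, 4 * ∫⁻ x in H, (‖b p.1‖₊ : ℝ≥0∞) ^ 2 *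
        (baseRect n m p.1).indicator (fun _ => (volume (baseRect n m p.1))⁻¹) x :=
        ENNReal.tsum_le_tsum h1
    _ = 4 * ∫⁻ x in H, sq2 n m 𝒞 b x := by
        rw [ENNReal.tsum_mul_left]
        unfold sq2
        rw [lintegral_tsum (fun p => (sq2_term_meas p).aemeasurable)]
    _ ≤ 4 * ∫⁻ x in H, thr (k+1) ^ 2 := by
        gcongr 4 * ?_
        apply setLIntegral_mono' hHm
        intro x hx
        have := pow_le_pow_left' (show (sq2 n m 𝒞 b x) ^ ((1:ℝ)/2) ≤ thr (k+1) from hx.2) 2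
        rwa [sq_half] at this
    _ ≤ 4 * (thr (k+1) ^ 2 * volume U) := by
        rw [setLIntegral_const]
        gcongr
        exact fun x hx => hx.1.2

lemma main_finite (hF : MeasurableSet F) (ω₁ : ℤ → Fin n → Bool) (ω₂ : ℤ → Fin m → Bool)
    (a : (ℤ × (Fin n → ℤ)) × (ℤ × (Fin m → ℤ)) → ℝ)
    (hC : ∀ p ∈ 𝒞, (99/100 : ℝ≥0∞) * volume (baseRect n m p) ≤ volume (baseRect n m p ∩ F))
    (hQ : ∫⁻ x in F, (sq2 n m 𝒞 b x) ^ ((1:ℝ)/2) ≠ ⊤)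
    (hN : bmoProdSeq (tRect n m ω₁ ω₂) (fun p : 𝒞 => tRect n m ω₁ ω₂ p.1)
      (fun p : 𝒞 => a p.1) ≠ ⊤) :
    (∑' p : 𝒞, ((‖a p.1‖₊ : ℝ≥0∞) * ‖b p.1‖₊)) ≤
      (8 * ((4 * 10 ^ m) * (4 * 10 ^ n))) *
        bmoProdSeq (tRect n m ω₁ ω₂) (fun p : 𝒞 => tRect n m ω₁ ω₂ p.1) (fun p : 𝒞 => a p.1) *
        ∫⁻ x in F, (sq2 n m 𝒞 b x) ^ ((1:ℝ)/2) := by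
  set Q := ∫⁻ x in F, (sq2 n m 𝒞 b x) ^ ((1:ℝ)/2) with hQdef
  set N := bmoProdSeq (tRect n m ω₁ ω₂) (fun p : 𝒞 => tRect n m ω₁ ω₂ p.1) (fun p : 𝒞 => a p.1)
  set K : ℝ≥0∞ := (4 * 10 ^ m) * (4 * 10 ^ n) with hK
  have hKt : K ≠ ⊤ := by
    simp only [hK]
    exact ENNReal.mul_ne_top (ENNReal.mul_ne_top (by simp) (ENNReal.pow_ne_top (by simp)))
      (ENNReal.mul_ne_top (by simp) (ENNReal.pow_ne_top (by simp)))
  -- level estimate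
  have hlev : ∀ k : ℤ, ∑' p : 𝒞, ((sel 𝒞 b F k).indicator (fun p => (‖a p‖₊ : ℝ≥0∞)) p.1 *
      (sel 𝒞 b F k).indicator (fun p => (‖b p‖₊ : ℝ≥0∞)) p.1) ≤
      (4 * K * N) * (thr k * volume (lev 𝒞 b F k)) := by
    intro k
    set B := sel 𝒞 b F k with hBdef
    set U : Set ((Fin n → ℝ) × (Fin m → ℝ)) := ⋃ p ∈ B, bigCube n p.1 ×ˢ bigCube m p.2 with hU
    have hUm : MeasurableSet U :=
      MeasurableSet.biUnion (Set.to_countable B) (fun p _ => (meas_big n p.1).prod (meas_big m p.2))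
    have hUv : volume U ≤ K * volume (lev 𝒞 b F k) := by
      have := two_param n m (lev 𝒞 b F k) (lev_meas hF k) B (fun p hp => hp.2.1)
      rwa [← mul_assoc] at this
    have hlt : volume (lev 𝒞 b F k) ≠ ⊤ := by
      intro h
      have := lev_markov (𝒞 := 𝒞) (b := b) hF k
      rw [h, ENNReal.mul_top (thr_ne_zero k), ← hQdef] at this
      exact hQ (top_le_iff.1 this)
    have hUt : volume U < ⊤ := hUv.trans_lt (ENNReal.mul_lt_top hKt.lt_top hlt.lt_top)
    have hbU : ∀ p ∈ B, bigCube n p.1 ×ˢ bigCube m p.2 ⊆ U := fun p hp =>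
      subset_biUnion_of_mem (u := fun p : (ℤ × (Fin n → ℤ)) × (ℤ × (Fin m → ℤ)) =>
        bigCube n p.1 ×ˢ bigCube m p.2) hp
    have hb2 := sel_b hF hC k U hUm (fun p hp => (base_sub n m p).trans (hbU p hp))
    have ha2 : ∑' p : 𝒞, B.indicator (fun p => (‖a p‖₊ : ℝ≥0∞)^2) p.1 ≤ N ^ 2 * volume U := by
      set Ω : Set ((Fin n → ℝ) × (Fin m → ℝ)) := ⋃ p ∈ B, tRect n m ω₁ ω₂ p with hΩ
      have hΩU : Ω ⊆ U := iUnion₂_subset (fun p hp => (tRect_sub n m ω₁ ω₂ p).trans (hbU p hp))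
      have hsub : ∀ p ∈ B, tRect n m ω₁ ω₂ p ⊆ Ω := fun p hp =>
        subset_biUnion_of_mem (u := fun p => tRect n m ω₁ ω₂ p) hp
      have h := bmo_le (tRect n m ω₁ ω₂) (fun p : 𝒞 => tRect n m ω₁ ω₂ p.1) (fun p : 𝒞 => a p.1) Ω
        ((measure_mono hΩU).trans_lt hUt) (by
          intro x hx
          simp only [hΩ, mem_iUnion, exists_prop] at hx
          obtain ⟨p, hp, hx⟩ := hx
          exact ⟨p, hx, hsub p hp⟩) hN
      calc _ ≤ ∑' p : 𝒞, ({p : 𝒞 | tRect n m ω₁ ω₂ p.1 ⊆ Ω}).indicator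
              (fun p : 𝒞 => (‖a p.1‖₊ : ℝ≥0∞)^2) p := by
            apply ENNReal.tsum_le_tsum
            intro p
            by_cases hp : p.1 ∈ B
            · rw [indicator_of_mem hp, indicator_of_mem (by exact hsub p.1 hp)]
            · rw [indicator_of_notMem hp]; exact zero_le
        _ = ∑' p : {p : 𝒞 // tRect n m ω₁ ω₂ p.1 ⊆ Ω}, (‖a p.1.1‖₊ : ℝ≥0∞)^2 := 
            (tsum_subtype {p : 𝒞 | tRect n m ω₁ ω₂ p.1 ⊆ Ω}
              (fun p : 𝒞 => (‖a p.1‖₊ : ℝ≥0∞)^2)).symm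
        _ ≤ N ^ 2 * volume Ω := h
        _ ≤ _ := by gcongr
    have hsq : ∀ (f : (ℤ × (Fin n → ℤ)) × (ℤ × (Fin m → ℤ)) → ℝ≥0∞) (p), (B.indicator f p)^2 =
        B.indicator (fun p => f p ^ 2) p := by
      intro f p
      by_cases hp : p ∈ B
      · rw [indicator_of_mem hp, indicator_of_mem hp]
      · rw [indicator_of_notMem hp, indicator_of_notMem hp]; simp
    refine (tsum_cs _ _).trans ?_
    simp only [hsq]
    calc _ ≤ (N ^ 2 * volume U) ^ ((1:ℝ)/2) * (4 * (thr (k+1) ^ 2 * volume U)) ^ ((1:ℝ)/2) := by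
          gcongr
      _ = ((2 * N * thr (k+1) * volume U) ^ 2) ^ ((1:ℝ)/2) := by
          rw [← ENNReal.mul_rpow_of_nonneg _ _ (by norm_num)]
          congr 1; ring
      _ = 2 * N * (2 * thr k) * volume U := by rw [half_sq, thr_succ]
      _ ≤ 2 * N * (2 * thr k) * (K * volume (lev 𝒞 b F k)) := by gcongr
      _ = _ := by ring
  calc (∑' p : 𝒞, ((‖a p.1‖₊ : ℝ≥0∞) * ‖b p.1‖₊))
      ≤ ∑' p : 𝒞, ∑' k : ℤ, ((sel 𝒞 b F k).indicator (fun p => (‖a p‖₊ : ℝ≥0∞)) p.1 *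
      (sel 𝒞 b F k).indicator (fun p => (‖b p‖₊ : ℝ≥0∞)) p.1) := by
        apply ENNReal.tsum_le_tsum
        intro p
        by_cases hb : b p.1 = 0
        · simp [hb]
        · obtain ⟨k, hk⟩ := exists_sel hF hC hQ p hb
          have := ENNReal.le_tsum (f := fun k : ℤ =>
            ((sel 𝒞 b F k).indicator (fun p => (‖a p‖₊ : ℝ≥0∞)) p.1 *
            (sel 𝒞 b F k).indicator (fun p => (‖b p‖₊ : ℝ≥0∞)) p.1)) k
          rwa [indicator_of_mem hk, indicator_of_mem hk] at this
    _ = ∑' k : ℤ, ∑' p : 𝒞, ((sel 𝒞 b F k).indicator (fun p => (‖a p‖₊ : ℝ≥0∞)) p.1 *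
      (sel 𝒞 b F k).indicator (fun p => (‖b p‖₊ : ℝ≥0∞)) p.1) := ENNReal.tsum_comm
    _ ≤ ∑' k : ℤ, (4 * K * N) * (thr k * volume (lev 𝒞 b F k)) := ENNReal.tsum_le_tsum hlev
    _ = (4 * K * N) * ∑' k : ℤ, ∫⁻ x in F, {s | thr k < s}.indicator (fun _ => thr k)
          ((sq2 n m 𝒞 b x) ^ ((1:ℝ)/2)) := by
        rw [ENNReal.tsum_mul_left]
        congr 2
        funext k
        have hm : MeasurableSet {x | thr k < (sq2 n m 𝒞 b x) ^ ((1:ℝ)/2)} :=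
          measurableSet_lt measurable_const sq_meas
        have : ∀ x, {s | thr k < s}.indicator (fun _ => thr k) ((sq2 n m 𝒞 b x) ^ ((1:ℝ)/2)) =
          {x | thr k < (sq2 n m 𝒞 b x) ^ ((1:ℝ)/2)}.indicator (fun _ => thr k) x := fun x => rfl
        simp only [this]
        rw [lintegral_indicator_const hm, Measure.restrict_apply hm, inter_comm]
        rfl
    _ = (4 * K * N) * ∫⁻ x in F, ∑' k : ℤ, {s | thr k < s}.indicator (fun _ => thr k)
          ((sq2 n m 𝒞 b x) ^ ((1:ℝ)/2)) := by
        rw [lintegral_tsum]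
        intro k
        exact ((measurable_const.indicator measurableSet_Ioi).comp sq_meas).aemeasurable
    _ ≤ (4 * K * N) * ∫⁻ x in F, 2 * ((sq2 n m 𝒞 b x) ^ ((1:ℝ)/2)) := by
        gcongr
        exact thr_sum _
    _ = 8 * K * N * Q := by
        rw [lintegral_const_mul _ sq_meas]
        ring

lemma main_all (hF : MeasurableSet F) (ω₁ : ℤ → Fin n → Bool) (ω₂ : ℤ → Fin m → Bool)
    (a : (ℤ × (Fin n → ℤ)) × (ℤ × (Fin m → ℤ)) → ℝ)
    (hC : ∀ p ∈ 𝒞, (99/100 : ℝ≥0∞) * volume (baseRect n m p) ≤ volume (baseRect n m p ∩ F)) :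
    (∑' p : 𝒞, ((‖a p.1‖₊ : ℝ≥0∞) * ‖b p.1‖₊)) ≤
      (8 * ((4 * 10 ^ m) * (4 * 10 ^ n))) *
        bmoProdSeq (tRect n m ω₁ ω₂) (fun p : 𝒞 => tRect n m ω₁ ω₂ p.1) (fun p : 𝒞 => a p.1) *
        ∫⁻ x in F, (sq2 n m 𝒞 b x) ^ ((1:ℝ)/2) := by
  by_cases ha : ∀ p : 𝒞, a p.1 = 0
  · simp [ha]
  by_cases hb : ∀ p : 𝒞, b p.1 = 0
  · simp [hb]
  push Not at ha hb
  obtain ⟨p, hp⟩ := ha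
  obtain ⟨q, hq⟩ := hb
  have hQ0 : ∫⁻ x in F, (sq2 n m 𝒞 b x) ^ ((1:ℝ)/2) ≠ 0 := by
    obtain ⟨s, hs0, hs⟩ := sq2_lower q hq
    have h1 : s * volume (baseRect n m q.1 ∩ F) ≤ ∫⁻ x in F, (sq2 n m 𝒞 b x) ^ ((1:ℝ)/2) := by
      rw [← Measure.restrict_apply (meas_base n m q.1),
        ← lintegral_indicator_const (meas_base n m q.1)]
      apply lintegral_mono
      intro x
      by_cases hx : x ∈ baseRect n m q.1
      · rw [indicator_of_mem hx]; exact hs x hx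
      · rw [indicator_of_notMem hx]; exact zero_le
    intro h
    rw [h] at h1
    have h2 := hC q.1 q.2
    rcases mul_eq_zero.1 (le_zero_iff.1 h1) with h3 | h3
    · exact hs0 h3
    · rw [h3] at h2
      rcases mul_eq_zero.1 (le_zero_iff.1 h2) with h4 | h4
      · simp at h4
      · exact vol_base_ne_zero n m q.1 h4
  have hN0 : bmoProdSeq (tRect n m ω₁ ω₂) (fun p : 𝒞 => tRect n m ω₁ ω₂ p.1)
      (fun p : 𝒞 => a p.1) ≠ 0 := by
    intro h
    have h1 := bmo_le (tRect n m ω₁ ω₂) (fun p : 𝒞 => tRect n m ω₁ ω₂ p.1) (fun p : 𝒞 => a p.1)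
      (tRect n m ω₁ ω₂ p.1) (vol_tRect_lt_top n m ω₁ ω₂ p.1)
      (fun x hx => ⟨p.1, hx, Subset.rfl⟩) (by rw [h]; simp)
    rw [h] at h1
    have h2 := (ENNReal.le_tsum (f := fun i : {i : 𝒞 // tRect n m ω₁ ω₂ i.1 ⊆ tRect n m ω₁ ω₂ p.1} =>
      ((‖a i.1.1‖₊ : ℝ≥0∞)) ^ 2) ⟨p, Subset.rfl⟩).trans h1
    simp at h2
    exact hp h2
  have hK0 : (8 * ((4 * 10 ^ m) * (4 * 10 ^ n)) : ℝ≥0∞) ≠ 0 := by positivity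
  by_cases hN : bmoProdSeq (tRect n m ω₁ ω₂) (fun p : 𝒞 => tRect n m ω₁ ω₂ p.1)
      (fun p : 𝒞 => a p.1) = ⊤
  · rw [hN, ENNReal.mul_top hK0, ENNReal.top_mul hQ0]; exact le_top
  by_cases hQ : ∫⁻ x in F, (sq2 n m 𝒞 b x) ^ ((1:ℝ)/2) = ⊤
  · rw [hQ, ENNReal.mul_top (mul_ne_zero hK0 hN0)]; exact le_top
  exact main_finite hF ω₁ ω₂ a hC hQ hN

end main

end DualityAux

/-- Duality-type estimate for product BMO coefficients with good rectangles: if every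
`R ∈ 𝒞 ⊆ 𝒟₀` satisfies `|R ∩ F| ≥ (99/100)|R|`, then for scalars `{a_{R+ω}}` and `{b_R}`,
`Σ_{R∈𝒞} |a_{R+ω} b_R| ≤ C ‖{a_{R+ω}}‖_{BMO_prod(𝒟_ω)} ∬_F (Σ_{R∈𝒞} |b_R|² 1_R/|R|)^{1/2}`,
with `C` depending only on the dimensions `n, m`. -/
theorem duality_bmo_prod (n m : ℕ) :
    ∃ C : ℝ≥0∞, 0 < C ∧ C ≠ ⊤ ∧
      ∀ (F : Set ((Fin n → ℝ) × (Fin m → ℝ)))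
        (ω₁ : ℤ → Fin n → Bool) (ω₂ : ℤ → Fin m → Bool)
        (𝒞 : Set ((ℤ × (Fin n → ℤ)) × (ℤ × (Fin m → ℤ))))
        (a b : (ℤ × (Fin n → ℤ)) × (ℤ × (Fin m → ℤ)) → ℝ),
        (∀ p ∈ 𝒞, (99/100 : ℝ≥0∞) * volume (baseRect n m p) ≤
          volume (baseRect n m p ∩ F)) →
        (∑' p : 𝒞, ((‖a p.1‖₊ : ℝ≥0∞) * ‖b p.1‖₊)) ≤
          C * bmoProdSeq (tRect n m ω₁ ω₂) (fun p : 𝒞 => tRect n m ω₁ ω₂ p.1)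
              (fun p : 𝒞 => a p.1) *
            ∫⁻ x in F,
              (∑' p : 𝒞, (‖b p.1‖₊ : ℝ≥0∞) ^ 2 *
                (baseRect n m p.1).indicator (fun _ => (volume (baseRect n m p.1))⁻¹) x)
                ^ ((1:ℝ)/2) := by
  refine ⟨8 * ((4 * 10 ^ m) * (4 * 10 ^ n)), by positivity, ?_, ?_⟩
  · exact ENNReal.mul_ne_top (by simp)
      (ENNReal.mul_ne_top (ENNReal.mul_ne_top (by simp) (ENNReal.pow_ne_top (by simp)))
        (ENNReal.mul_ne_top (by simp) (ENNReal.pow_ne_top (by simp))))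
  · intro F ω₁ ω₂ 𝒞 a b hC
    rw [← Measure.restrict_toMeasurable_of_sFinite F]
    exact DualityAux.main_all (measurableSet_toMeasurable volume F) ω₁ ω₂ a
      (fun p hp => (hC p hp).trans (by gcongr; exact subset_toMeasurable volume F))

end
end
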